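/- arXiv:0704.1691 — 6 statements merged into one kernel-verified Lean document; each statement's English description precedes it below -/
import Mathlib

section
/- Let U ∈ GL(n, ℂ), A ∈ SM(n, ℂ) and P ∈ ℂ[z_1, …, z_n]. Then P is Δ_A-nilpotent if and only if the polynomial P(U^{-1}z) is Δ_{UAU^T}-nilpotent. -/
open MvPolynomial

noncomputable def Delta {n : ℕ} (A : Matrix (Fin n) (Fin n) ℂ) :
    Module.End ℂ (MvPolynomial (Fin n) ℂ) :=
  ∑ i, ∑ j, A i j • ((pderiv i).toLinearMap ∘ₗ (pderiv j).toLinearMap)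

/-- The substitution automorphism `Φ_U : P(z) ↦ P(U⁻¹z)`. -/
noncomputable def Phi {n : ℕ} (U : Matrix (Fin n) (Fin n) ℂ) :
    MvPolynomial (Fin n) ℂ →ₐ[ℂ] MvPolynomial (Fin n) ℂ :=
  aeval fun i => ∑ j, C (U⁻¹ i j) * X j

/-- `P` is `Λ`-nilpotent: `Λ^m(P^m) = 0` for all `m ≥ 1`. -/
def LNil {n : ℕ} (Λ : Module.End ℂ (MvPolynomial (Fin n) ℂ))
    (P : MvPolynomial (Fin n) ℂ) : Prop :=
  ∀ m : ℕ, 1 ≤ m → (Λ ^ m) (P ^ m) = 0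

theorem Phi_X {n : ℕ} (U : Matrix (Fin n) (Fin n) ℂ) (i : Fin n) :
    Phi U (X i) = ∑ j, C (U⁻¹ i j) * X j := by
  simp [Phi]

theorem Phi_injective {n : ℕ} {U : Matrix (Fin n) (Fin n) ℂ} (hU : IsUnit U) :
    Function.Injective (Phi U) := by
  have hdet := (Matrix.isUnit_iff_isUnit_det U).mp hU
  have hcomp : (Phi U⁻¹).comp (Phi U) = AlgHom.id ℂ _ := by
    ext1 i
    have hentry (k : Fin n) : ∑ j, U⁻¹ i j * U j k = if i = k then 1 else 0 := by
      rw [← Matrix.mul_apply, Matrix.nonsing_inv_mul U hdet, Matrix.one_apply]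
    simp only [AlgHom.comp_apply, Phi_X, map_sum, map_mul, Matrix.nonsing_inv_nonsing_inv U hdet,
      AlgHom.id_apply, algHom_C, algebraMap_eq, Finset.mul_sum]
    rw [Finset.sum_comm]
    simp only [← mul_assoc, ← C_mul, ← Finset.sum_mul, ← map_sum, hentry]
    simp
  exact Function.LeftInverse.injective (g := Phi U⁻¹) fun P => DFunLike.congr_fun hcomp P

theorem pderiv_Phi_X {n : ℕ} (U : Matrix (Fin n) (Fin n) ℂ) (i j : Fin n) :
    pderiv j (Phi U (X i)) = C (U⁻¹ i j) := by
  simp [Phi_X, pderiv_X, Pi.single_apply]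

/-- The chain rule for the linear substitution `Phi U`. -/
theorem Phi_pderiv {n : ℕ} {U : Matrix (Fin n) (Fin n) ℂ} (hU : IsUnit U) (k : Fin n)
    (P : MvPolynomial (Fin n) ℂ) :
    Phi U (pderiv k P) = ∑ j, U j k • pderiv j (Phi U P) := by
  have hdet := (Matrix.isUnit_iff_isUnit_det U).mp hU
  induction P using MvPolynomial.induction_on with
  | C a => simp [Phi]
  | add p q hp hq => simp only [map_add, hp, hq, smul_add, Finset.sum_add_distrib]
  | mul_X p i hp =>
    have hentry : ∑ j, U j k * U⁻¹ i j = if i = k then 1 else 0 := by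
      simp_rw [mul_comm (U _ k)]
      rw [← Matrix.mul_apply, Matrix.nonsing_inv_mul U hdet, Matrix.one_apply]
    have hX : Phi U (pderiv k (X i)) = ∑ j, U j k • pderiv j (Phi U (X i)) := by
      simp only [pderiv_Phi_X, smul_eq_C_mul, ← C_mul, ← map_sum, hentry, pderiv_X,
        Pi.single_apply]
      split_ifs <;> simp_all
    simp only [map_mul, Derivation.leibniz, map_add, smul_eq_mul, hp, hX, smul_add,
      Finset.sum_add_distrib, Finset.mul_sum, mul_smul_comm]

theorem Delta_apply {n : ℕ} (A : Matrix (Fin n) (Fin n) ℂ) (P : MvPolynomial (Fin n) ℂ) :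
    Delta A P = ∑ i, ∑ j, A i j • pderiv i (pderiv j P) := by
  simp [Delta, LinearMap.sum_apply]

theorem Delta_Phi {n : ℕ} {U : Matrix (Fin n) (Fin n) ℂ} (hU : IsUnit U)
    (A : Matrix (Fin n) (Fin n) ℂ) (P : MvPolynomial (Fin n) ℂ) :
    Delta (U * A * U.transpose) (Phi U P) = Phi U (Delta A P) := by
  simp only [Delta_apply, map_sum, map_smul, Phi_pderiv hU, Derivation.map_smul, Matrix.mul_apply,
    Matrix.transpose_apply, Finset.sum_mul, Finset.sum_smul, Finset.smul_sum, smul_smul]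
  calc
    _ = ∑ i, ∑ l, ∑ j, ∑ k, (U i k * A k l * U j l) • pderiv i (pderiv j (Phi U P)) :=
      Finset.sum_congr rfl fun i _ => Finset.sum_comm
    _ = ∑ i, ∑ l, ∑ k, ∑ j, (U i k * A k l * U j l) • pderiv i (pderiv j (Phi U P)) :=
      Finset.sum_congr rfl fun i _ => Finset.sum_congr rfl fun l _ => Finset.sum_comm
    _ = ∑ i, ∑ k, ∑ l, ∑ j, (U i k * A k l * U j l) • pderiv i (pderiv j (Phi U P)) :=
      Finset.sum_congr rfl fun i _ => Finset.sum_comm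
    _ = ∑ k, ∑ i, ∑ l, ∑ j, (U i k * A k l * U j l) • pderiv i (pderiv j (Phi U P)) :=
      Finset.sum_comm
    _ = ∑ k, ∑ l, ∑ i, ∑ j, (U i k * A k l * U j l) • pderiv i (pderiv j (Phi U P)) :=
      Finset.sum_congr rfl fun k _ => Finset.sum_comm
    _ = _ := by
      refine Finset.sum_congr rfl fun k _ => Finset.sum_congr rfl fun l _ =>
        Finset.sum_congr rfl fun i _ => Finset.sum_congr rfl fun j _ => ?_
      congr 1
      ring

theorem Delta_pow_Phi {n : ℕ} {U : Matrix (Fin n) (Fin n) ℂ} (hU : IsUnit U)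
    (A : Matrix (Fin n) (Fin n) ℂ) (m : ℕ) (P : MvPolynomial (Fin n) ℂ) :
    (Delta (U * A * U.transpose) ^ m) (Phi U P) = Phi U ((Delta A ^ m) P) := by
  induction m generalizing P with
  | zero => simp
  | succ m ih => simp only [pow_succ, Module.End.mul_apply, Delta_Phi hU, ih]

/-- `P` is `Δ_A`-nilpotent iff `P(U⁻¹z)` is `Δ_{UAUᵀ}`-nilpotent. -/
theorem stmt1 {n : ℕ} (U A : Matrix (Fin n) (Fin n) ℂ) (hU : IsUnit U)
    (hA : A.IsSymm) (P : MvPolynomial (Fin n) ℂ) :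
    LNil (Delta A) P ↔ LNil (Delta (U * A * U.transpose)) (Phi U P) := by
  refine forall₂_congr fun m _ => ?_
  rw [← map_pow, Delta_pow_Phi hU, map_eq_zero_iff _ (Phi_injective hU)]
end

section
/- Suppose HVC[n] holds for some full-rank second-order homogeneous constant-coefficient operator Δ_A with A ∈ SM(n, ℂ) invertible. Then for every 1 ≤ k ≤ n, HVC[k] holds for Δ_B for every invertible symmetric matrix B ∈ SM(k, ℂ). -/
open MvPolynomial

/-- The Vanishing Conjecture holds for `Λ`. -/
def VC {n : ℕ} (Λ : Module.End ℂ (MvPolynomial (Fin n) ℂ)) : Prop :=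
  ∀ P : MvPolynomial (Fin n) ℂ, LNil Λ P →
    ∃ N : ℕ, ∀ m : ℕ, N ≤ m → (Λ ^ m) (P ^ (m + 1)) = 0

/-- The homogeneous Vanishing Conjecture holds for `Λ`. -/
def HVC {n : ℕ} (Λ : Module.End ℂ (MvPolynomial (Fin n) ℂ)) : Prop :=
  ∀ P : MvPolynomial (Fin n) ℂ, (∃ d : ℕ, P.IsHomogeneous d) → LNil Λ P →
    ∃ N : ℕ, ∀ m : ℕ, N ≤ m → (Λ ^ m) (P ^ (m + 1)) = 0

open scoped Matrix in
/-- A nonsingular symmetric matrix over an algebraically closed field has the form `Cᵀ * C`. -/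
theorem Matrix.IsSymm.exists_transpose_mul_self_eq {K : Type*} [Field K] [IsAlgClosed K]
    [Invertible (2 : K)] {n : ℕ} {S : Matrix (Fin n) (Fin n) K} (hS : S.IsSymm) (hu : IsUnit S) :
    ∃ C : Matrix (Fin n) (Fin n) K, Cᵀ * C = S := by
  have assoc : ∀ T : Matrix (Fin n) (Fin n) K, T.IsSymm →
      QuadraticMap.associated (R := K) T.toQuadraticForm' = Matrix.toLinearMap₂' K T := by
    intro T hT
    refine QuadraticMap.associated_left_inverse K ?_
    intro x y
    simp only [Matrix.toLinearMap₂'_apply']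
    rw [Matrix.dotProduct_mulVec, ← Matrix.mulVec_transpose, hT.eq, dotProduct_comm]
  have toM : ∀ T : Matrix (Fin n) (Fin n) K, T.IsSymm → T.toQuadraticForm'.toMatrix' = T := by
    intro T hT
    rw [QuadraticForm.toMatrix', assoc T hT, LinearMap.toMatrix'_toLinearMap₂']
  have sep : ∀ T : Matrix (Fin n) (Fin n) K, T.IsSymm → IsUnit T →
      (QuadraticMap.associated (R := K) T.toQuadraticForm').SeparatingLeft := by
    intro T hT hTu
    rw [assoc T hT, Matrix.separatingLeft_toLinearMap₂'_iff, Matrix.separatingLeft_iff_det_ne_zero]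
    exact ((Matrix.isUnit_iff_isUnit_det T).1 hTu).ne_zero
  obtain ⟨e⟩ := QuadraticForm.equivalent_of_isAlgClosed _ _ (sep S hS hu)
    (sep 1 Matrix.isSymm_one isUnit_one)
  refine ⟨LinearMap.toMatrix' (e.toLinearEquiv : (Fin n → K) →ₗ[K] (Fin n → K)), ?_⟩
  have hcomp : (1 : Matrix (Fin n) (Fin n) K).toQuadraticForm'.comp
      (e.toLinearEquiv : (Fin n → K) →ₗ[K] (Fin n → K)) = S.toQuadraticForm' :=
    QuadraticMap.ext fun x => e.map_app x
  have h := QuadraticForm.toMatrix'_comp (1 : Matrix (Fin n) (Fin n) K).toQuadraticForm'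
    (e.toLinearEquiv : (Fin n → K) →ₗ[K] (Fin n → K))
  rw [hcomp, toM S hS, toM 1 Matrix.isSymm_one, Matrix.mul_one] at h
  exact h.symm

open scoped Matrix in
/-- A nonsingular quadratic form in at most `n` variables is a restriction of any nonsingular
quadratic form in `n` variables. -/
theorem Matrix.IsSymm.exists_mul_mul_transpose_eq {K : Type*} [Field K] [IsAlgClosed K]
    [Invertible (2 : K)] {n k : ℕ} (hkn : k ≤ n)
    {A : Matrix (Fin n) (Fin n) K} (hA : A.IsSymm) (hAu : IsUnit A)
    {B : Matrix (Fin k) (Fin k) K} (hB : B.IsSymm) (hBu : IsUnit B) :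
    ∃ M : Matrix (Fin k) (Fin n) K, M * A * Mᵀ = B := by
  obtain ⟨C, rfl⟩ := hA.exists_transpose_mul_self_eq hAu
  obtain ⟨D, rfl⟩ := hB.exists_transpose_mul_self_eq hBu
  have hC : IsUnit C.det := by
    rw [Matrix.isUnit_iff_isUnit_det, Matrix.det_mul] at hAu
    exact isUnit_of_mul_isUnit_right hAu
  let E : Matrix (Fin k) (Fin n) K := (1 : Matrix (Fin n) (Fin n) K).submatrix (Fin.castLE hkn) id
  have hE : E * Eᵀ = 1 := by
    rw [Matrix.transpose_submatrix, Matrix.transpose_one,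
      ← Matrix.submatrix_mul _ _ _ _ _ Function.bijective_id, Matrix.one_mul,
      Matrix.submatrix_one _ (Fin.castLE_injective hkn)]
  refine ⟨Dᵀ * E * (C⁻¹)ᵀ, ?_⟩
  have h₁ : (C⁻¹)ᵀ * Cᵀ = 1 := by
    rw [← Matrix.transpose_mul, Matrix.mul_nonsing_inv _ hC, Matrix.transpose_one]
  calc Dᵀ * E * (C⁻¹)ᵀ * (Cᵀ * C) * (Dᵀ * E * (C⁻¹)ᵀ)ᵀ
      = Dᵀ * E * ((C⁻¹)ᵀ * Cᵀ) * (C * C⁻¹) * Eᵀ * D := by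
        simp only [Matrix.transpose_mul, Matrix.transpose_transpose, Matrix.mul_assoc]
    _ = Dᵀ * (E * Eᵀ) * D := by
        rw [h₁, Matrix.mul_nonsing_inv _ hC]
        simp only [Matrix.mul_one, Matrix.mul_assoc]
    _ = Dᵀ * D := by rw [hE, Matrix.mul_one]

namespace MvPolynomial

variable {R σ τ : Type*} [CommSemiring R] [Fintype τ]

/-- The substitution `X i ↦ ∑ j, M i j * X j`. -/
noncomputable def linearSubst (M : Matrix σ τ R) : MvPolynomial σ R →ₐ[R] MvPolynomial τ R :=
  aeval fun i => ∑ j, M i j • X j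

@[simp]
theorem linearSubst_X (M : Matrix σ τ R) (i : σ) :
    linearSubst M (X i) = ∑ j, M i j • (X j : MvPolynomial τ R) := by
  simp [linearSubst]

theorem IsHomogeneous.linearSubst {P : MvPolynomial σ R} {d : ℕ} (hP : P.IsHomogeneous d)
    (M : Matrix σ τ R) : (MvPolynomial.linearSubst M P).IsHomogeneous d := by
  rw [← one_mul d]
  refine hP.aeval _ fun i => IsHomogeneous.sum _ _ _ fun j _ => ?_
  rw [smul_eq_C_mul]
  exact isHomogeneous_C_mul_X _ _

theorem linearSubst_injective [Fintype σ] [DecidableEq σ] {M : Matrix σ τ R} {N : Matrix τ σ R}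
    (h : M * N = 1) : Function.Injective (linearSubst M) := by
  have hid : (linearSubst N).comp (linearSubst M) = AlgHom.id R _ := by
    ext1 i
    simp only [AlgHom.comp_apply, linearSubst_X, map_sum, map_smul, Finset.smul_sum, smul_smul,
      AlgHom.id_apply]
    rw [Finset.sum_comm]
    simp only [← Finset.sum_smul, ← Matrix.mul_apply, h, Matrix.one_apply, ite_smul, one_smul,
      zero_smul, Finset.sum_ite_eq, Finset.mem_univ, if_true]
  exact Function.LeftInverse.injective (g := linearSubst N) fun P => DFunLike.congr_fun hid P

theorem pderiv_linearSubst [Fintype σ] (M : Matrix σ τ R) (j : τ) (P : MvPolynomial σ R) :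
    pderiv j (linearSubst M P) = ∑ i, M i j • linearSubst M (pderiv i P) := by
  classical
  induction P using MvPolynomial.induction_on with
  | C a => simp [linearSubst]
  | add p q hp hq => simp only [map_add, hp, hq, smul_add, Finset.sum_add_distrib]
  | mul_X p l hp =>
    have hX : pderiv j (linearSubst M (X l)) = C (M l j) := by
      simp [pderiv_X, Pi.single_apply, smul_eq_C_mul]
    have hl : ∑ i, M i j • linearSubst M (pderiv i (X l)) = C (M l j) := by
      simp [pderiv_X, Pi.single_apply, apply_ite, smul_eq_C_mul]
    simp only [map_mul, Derivation.leibniz, smul_eq_mul, map_add, smul_add,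
      Finset.sum_add_distrib]
    rw [hX, hp, ← hl, Finset.mul_sum, Finset.mul_sum]
    simp only [mul_smul_comm]

end MvPolynomial

theorem Delta_linearSubst {n k : ℕ} (A : Matrix (Fin n) (Fin n) ℂ) (M : Matrix (Fin k) (Fin n) ℂ)
    (P : MvPolynomial (Fin k) ℂ) :
    Delta A (linearSubst M P) = linearSubst M (Delta (M * A * M.transpose) P) := by
  have hl : Delta A (linearSubst M P) = ∑ i, ∑ j, ∑ b, ∑ a,
      (A i j * (M b j * M a i)) • linearSubst M (pderiv a (pderiv b P)) := by
    simp only [Delta, LinearMap.sum_apply, LinearMap.smul_apply, LinearMap.comp_apply,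
      Derivation.coeFn_coe, pderiv_linearSubst, map_sum, Derivation.map_smul,
      Finset.smul_sum, smul_smul]
  have hr : linearSubst M (Delta (M * A * M.transpose) P) = ∑ a, ∑ b, ∑ j, ∑ i,
      (A i j * (M b j * M a i)) • linearSubst M (pderiv a (pderiv b P)) := by
    simp only [Delta, LinearMap.sum_apply, LinearMap.smul_apply, LinearMap.comp_apply,
      Derivation.coeFn_coe, map_sum, map_smul, Matrix.mul_apply, Matrix.transpose_apply,
      Finset.sum_mul, Finset.sum_smul]
    refine Finset.sum_congr rfl fun a _ => Finset.sum_congr rfl fun b _ =>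
      Finset.sum_congr rfl fun j _ => Finset.sum_congr rfl fun i _ => ?_
    congr 1
    ring
  have hcomm : ∀ f : Fin n → Fin n → Fin k → Fin k → MvPolynomial (Fin n) ℂ,
      ∑ i, ∑ j, ∑ b, ∑ a, f i j b a = ∑ a, ∑ b, ∑ j, ∑ i, f i j b a := by
    intro f
    simp only [← Fintype.sum_prod_type']
    exact Fintype.sum_equiv
      ⟨fun x => (x.2.2.2, x.2.2.1, x.2.1, x.1), fun x => (x.2.2.2, x.2.2.1, x.2.1, x.1),
        fun _ => rfl, fun _ => rfl⟩ _ _ fun _ => rfl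
  rw [hl, hr, hcomm]

theorem Delta_pow_linearSubst {n k : ℕ} (A : Matrix (Fin n) (Fin n) ℂ)
    (M : Matrix (Fin k) (Fin n) ℂ) (m : ℕ) (P : MvPolynomial (Fin k) ℂ) :
    (Delta A ^ m) (linearSubst M P) =
      linearSubst M ((Delta (M * A * M.transpose) ^ m) P) := by
  induction m generalizing P with
  | zero => simp
  | succ m ih => simp only [pow_succ, Module.End.mul_apply, Delta_linearSubst, ih]

theorem HVC.of_mul_mul_transpose {n k : ℕ} {A : Matrix (Fin n) (Fin n) ℂ} (h : HVC (Delta A))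
    (M : Matrix (Fin k) (Fin n) ℂ) (hM : IsUnit (M * A * M.transpose)) :
    HVC (Delta (M * A * M.transpose)) := by
  rintro P ⟨d, hd⟩ hnil
  have hinj : Function.Injective (linearSubst M) :=
    linearSubst_injective (N := A * M.transpose * (M * A * M.transpose)⁻¹) <| by
      rw [← Matrix.mul_assoc, ← Matrix.mul_assoc]
      exact Matrix.mul_nonsing_inv _ ((Matrix.isUnit_iff_isUnit_det _).1 hM)
  obtain ⟨N, hN⟩ := h (linearSubst M P) ⟨d, hd.linearSubst M⟩ fun m hm => by
    rw [← map_pow, Delta_pow_linearSubst, hnil m hm, map_zero]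
  refine ⟨N, fun m hm => hinj ?_⟩
  rw [← Delta_pow_linearSubst, map_pow, hN m hm, map_zero]

/-- If `HVC[n]` holds for a full-rank `Δ_A`, then for every `1 ≤ k ≤ n`, `HVC[k]` holds
for `Δ_B` for every invertible symmetric `B ∈ SM(k, ℂ)`. -/
theorem stmt3 {n : ℕ} (A : Matrix (Fin n) (Fin n) ℂ) (hA : A.IsSymm) (hAu : IsUnit A)
    (h : HVC (Delta A)) :
    ∀ k : ℕ, 1 ≤ k → k ≤ n → ∀ B : Matrix (Fin k) (Fin k) ℂ, B.IsSymm → IsUnit B →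
      HVC (Delta B) := by
  intro k _ hkn B hB hBu
  obtain ⟨M, rfl⟩ := hA.exists_mul_mul_transpose_eq hkn hAu hB hBu
  exact h.of_mul_mul_transpose M hBu
end

section
/- Suppose VC[n] holds for some full-rank second-order homogeneous constant-coefficient operator Δ_A with A ∈ SM(n, ℂ) invertible. Then for every m ≥ n, VC[m] holds for Δ_B for every symmetric matrix B ∈ SM(m, ℂ) of rank n. -/
open MvPolynomial

/-- A complex symmetric matrix of rank `n` factors as `R * Rᵀ` with `R` having `n` columns. -/
theorem Matrix.IsSymm.exists_eq_mul_transpose {m n : ℕ} {B : Matrix (Fin m) (Fin m) ℂ}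
    (hB : B.IsSymm) (hr : B.rank = n) :
    ∃ R : Matrix (Fin m) (Fin n) ℂ, B = R * R.transpose := by
  classical
  have hsymm : LinearMap.IsSymm (Matrix.toBilin' B) := by
    refine ⟨fun x y => ?_⟩
    simp only [Matrix.toBilin'_apply', RingHom.id_apply]
    rw [Matrix.dotProduct_mulVec, ← Matrix.mulVec_transpose, hB.eq, dotProduct_comm]
  obtain ⟨v, hv⟩ := LinearMap.BilinForm.exists_orthogonal_basis hsymm
  set U := v.toMatrix (Pi.basisFun ℂ (Fin m))
  set w := fun i => Matrix.toBilin' B (v i) (v i)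
  have hdiag : LinearMap.BilinForm.toMatrix v (Matrix.toBilin' B) = Matrix.diagonal w := by
    ext i j
    rw [LinearMap.BilinForm.toMatrix_apply, Matrix.diagonal_apply]
    split_ifs with hij
    · rw [hij]
    · exact hv hij
  have hfac : B = U.transpose * Matrix.diagonal w * U := by
    have := LinearMap.BilinForm.toMatrix_mul_basis_toMatrix v (Pi.basisFun ℂ (Fin m))
      (Matrix.toBilin' B)
    rw [hdiag, LinearMap.BilinForm.toMatrix_basisFun, LinearMap.BilinForm.toMatrix'_toBilin']
      at this
    exact this.symm
  have hfac' : LinearMap.BilinForm.toMatrix v (Matrix.toBilin' B) =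
      ((Pi.basisFun ℂ (Fin m)).toMatrix v).transpose * B * (Pi.basisFun ℂ (Fin m)).toMatrix v := by
    rw [← LinearMap.BilinForm.toMatrix_mul_basis_toMatrix (Pi.basisFun ℂ (Fin m)) v,
      LinearMap.BilinForm.toMatrix_basisFun, LinearMap.BilinForm.toMatrix'_toBilin']
  have hcard : Fintype.card {i // w i ≠ 0} = n := by
    rw [← Matrix.rank_diagonal, ← hr]
    apply le_antisymm
    · rw [← hdiag, hfac']
      exact (Matrix.rank_mul_le_left _ _).trans (Matrix.rank_mul_le_right _ _)
    · conv_lhs => rw [hfac]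
      exact (Matrix.rank_mul_le_left _ _).trans (Matrix.rank_mul_le_right _ _)
  let e : Fin n ≃ {i // w i ≠ 0} := (Fintype.equivFinOfCardEq hcard).symm
  choose s hs using fun i => IsAlgClosed.exists_pow_nat_eq (w i) two_pos
  refine ⟨Matrix.of fun i k => U (e k) i * s (e k), ?_⟩
  ext i j
  rw [hfac, Matrix.mul_apply, Matrix.mul_apply]
  simp only [Matrix.mul_diagonal, Matrix.transpose_apply, Matrix.of_apply]
  rw [e.sum_comp (fun k : {i // w i ≠ 0} => U k i * s k * (U k j * s k)),
    ← Fintype.sum_subtype_add_sum_subtype (fun k => w k ≠ 0)]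
  have hzero : ∑ k : {k // ¬ w k ≠ 0}, U k i * w k * U k j = 0 :=
    Finset.sum_eq_zero fun k _ => by rw [not_not.1 k.2, mul_zero, zero_mul]
  rw [hzero, add_zero]
  refine Finset.sum_congr rfl fun k _ => ?_
  rw [← hs k]
  ring

/-- Countably many nonzero complex polynomials have a common point of nonvanishing. -/
theorem MvPolynomial.exists_forall_eval_ne_zero {σ ι : Type*} [Finite σ] [Countable ι]
    (Q : ι → MvPolynomial σ ℂ) (hQ : ∀ i, Q i ≠ 0) : ∃ c : σ → ℂ, ∀ i, eval c (Q i) ≠ 0 := by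
  cases nonempty_fintype σ
  have hopen : ∀ i, IsOpen {c : σ → ℂ | eval c (Q i) ≠ 0} := fun i =>
    isOpen_ne_fun (MvPolynomial.continuous_eval (Q i)) continuous_const
  have hdense : ∀ i, Dense {c : σ → ℂ | eval c (Q i) ≠ 0} := by
    intro i x
    rw [mem_closure_iff_nhds]
    intro t ht
    by_contra hne
    rw [nhds_pi, Filter.mem_pi'] at ht
    obtain ⟨I, u, hu, hut⟩ := ht
    refine hQ i (MvPolynomial.funext_set u (fun k => infinite_of_mem_nhds (x k) (hu k)) ?_)
    intro y hy
    by_contra hy0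
    exact hne ⟨y, hut fun k _ => hy k trivial, by simpa using hy0⟩
  obtain ⟨c, hc⟩ := (dense_iInter_of_isOpen hopen hdense).nonempty
  exact ⟨c, fun i => Set.mem_iInter.1 hc i⟩

/-- Restriction of a polynomial to the parametrized affine subspace `y ↦ c + T y`. -/
noncomputable def affineSubst {m n : ℕ} (T : Matrix (Fin m) (Fin n) ℂ) (c : Fin m → ℂ) :
    MvPolynomial (Fin m) ℂ →ₐ[ℂ] MvPolynomial (Fin n) ℂ :=
  aeval fun i => C (c i) + ∑ j, C (T i j) * X j

theorem eval_zero_affineSubst {m n : ℕ} (T : Matrix (Fin m) (Fin n) ℂ) (c : Fin m → ℂ)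
    (P : MvPolynomial (Fin m) ℂ) : eval 0 (affineSubst T c P) = eval c P := by
  induction P using MvPolynomial.induction_on with
  | C a => simp [affineSubst]
  | add p q hp hq => rw [map_add, map_add, map_add, hp, hq]
  | mul_X p i h =>
    rw [map_mul, map_mul, h]
    simp [affineSubst]

theorem pderiv_affineSubst {m n : ℕ} (T : Matrix (Fin m) (Fin n) ℂ) (c : Fin m → ℂ)
    (j : Fin n) (P : MvPolynomial (Fin m) ℂ) :
    pderiv j (affineSubst T c P) = ∑ i, T i j • affineSubst T c (pderiv i P) := by
  classical
  induction P using MvPolynomial.induction_on with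
  | C a => simp [affineSubst]
  | add p q hp hq => simp [hp, hq, Finset.sum_add_distrib]
  | mul_X p k h =>
    have hX : pderiv j (affineSubst T c (X k)) = C (T k j) := by
      simp [affineSubst, pderiv_X, Pi.single_apply]
    simp only [map_mul, Derivation.leibniz, hX, h, map_add, smul_add, smul_eq_mul, pderiv_X,
      Finset.sum_add_distrib, Finset.mul_sum, mul_smul_comm]
    congr 1
    simp [Pi.single_apply, MvPolynomial.smul_eq_C_mul, mul_comm]

theorem sum_reverse₄ {α β γ δ M : Type*} [Fintype α] [Fintype β] [Fintype γ] [Fintype δ]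
    [AddCommMonoid M] (f : α → β → γ → δ → M) :
    ∑ a, ∑ b, ∑ c, ∑ d, f a b c d = ∑ d, ∑ c, ∑ b, ∑ a, f a b c d := by
  calc ∑ a, ∑ b, ∑ c, ∑ d, f a b c d = ∑ a, ∑ d, ∑ c, ∑ b, f a b c d :=
        Finset.sum_congr rfl fun a _ => by
          rw [Finset.sum_comm, Finset.sum_congr rfl fun _ _ => Finset.sum_comm, Finset.sum_comm]
    _ = ∑ d, ∑ c, ∑ a, ∑ b, f a b c d := by
          rw [Finset.sum_comm, Finset.sum_congr rfl fun _ _ => Finset.sum_comm]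
    _ = ∑ d, ∑ c, ∑ b, ∑ a, f a b c d :=
        Finset.sum_congr rfl fun _ _ => Finset.sum_congr rfl fun _ _ => Finset.sum_comm

theorem Delta_affineSubst {m n : ℕ} (A : Matrix (Fin n) (Fin n) ℂ)
    (T : Matrix (Fin m) (Fin n) ℂ) (c : Fin m → ℂ) (P : MvPolynomial (Fin m) ℂ) :
    Delta A (affineSubst T c P) = affineSubst T c (Delta (T * A * T.transpose) P) := by
  simp only [Delta, LinearMap.sum_apply, LinearMap.smul_apply, LinearMap.comp_apply,
    Derivation.coeFn_coe, map_sum, map_smul, pderiv_affineSubst, Matrix.mul_apply,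
    Matrix.transpose_apply, Finset.smul_sum, Finset.sum_smul, smul_smul, Finset.sum_mul]
  rw [sum_reverse₄]
  refine Finset.sum_congr rfl fun i _ => Finset.sum_congr rfl fun l _ =>
    Finset.sum_congr rfl fun k _ => Finset.sum_congr rfl fun j _ => ?_
  congr 1
  ring

theorem Delta_pow_affineSubst {m n : ℕ} (A : Matrix (Fin n) (Fin n) ℂ)
    (T : Matrix (Fin m) (Fin n) ℂ) (c : Fin m → ℂ) (k : ℕ) (P : MvPolynomial (Fin m) ℂ) :
    (Delta A ^ k) (affineSubst T c P) =
      affineSubst T c ((Delta (T * A * T.transpose) ^ k) P) := by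
  induction k with
  | zero => rfl
  | succ k ih => rw [pow_succ', pow_succ', Module.End.mul_apply, Module.End.mul_apply, ih,
      Delta_affineSubst]

/-- The Vanishing Conjecture is inherited by every operator pulled back along a linear map. -/
theorem VC.conj {m n : ℕ} {A : Matrix (Fin n) (Fin n) ℂ} (h : VC (Delta A))
    (T : Matrix (Fin m) (Fin n) ℂ) : VC (Delta (T * A * T.transpose)) := by
  intro P hP
  set Q : ℕ → MvPolynomial (Fin m) ℂ :=
    fun k => (Delta (T * A * T.transpose) ^ k) (P ^ (k + 1))
  obtain ⟨c, hc⟩ := MvPolynomial.exists_forall_eval_ne_zero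
    (fun k : {k // Q k ≠ 0} => Q k) (fun k => k.2)
  obtain ⟨N, hN⟩ := h (affineSubst T c P) fun k hk => by
    rw [← map_pow, Delta_pow_affineSubst, hP k hk, map_zero]
  refine ⟨N, fun k hk => ?_⟩
  by_contra hne
  refine hc ⟨k, hne⟩ ?_
  rw [← eval_zero_affineSubst T c, ← Delta_pow_affineSubst, map_pow, hN k hk, map_zero]

/-- If `VC[n]` holds for a full-rank `Δ_A`, then for every `m ≥ n`, `VC[m]` holds for
`Δ_B` for every symmetric `B ∈ SM(m, ℂ)` of rank `n`. -/
theorem stmt4 {n : ℕ} (A : Matrix (Fin n) (Fin n) ℂ) (hA : A.IsSymm) (hAu : IsUnit A)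
    (h : VC (Delta A)) :
    ∀ m : ℕ, n ≤ m → ∀ B : Matrix (Fin m) (Fin m) ℂ, B.IsSymm → B.rank = n →
      VC (Delta B) := by
  intro m _ B hB hr
  obtain ⟨S, hS⟩ := hA.exists_eq_mul_transpose
    ((Matrix.rank_of_isUnit A hAu).trans (Fintype.card_fin n))
  obtain ⟨R, hR⟩ := hB.exists_eq_mul_transpose hr
  have hSu : IsUnit S.det := by
    rw [Matrix.isUnit_iff_isUnit_det, hS, Matrix.det_mul] at hAu
    exact isUnit_of_mul_isUnit_left hAu
  have hBT : B = R * S⁻¹ * A * (R * S⁻¹).transpose := by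
    have h1 : S.transpose * S⁻¹.transpose = 1 := by
      rw [← Matrix.transpose_mul, Matrix.nonsing_inv_mul S hSu, Matrix.transpose_one]
    calc B = R * (S⁻¹ * S) * (S.transpose * S⁻¹.transpose) * R.transpose := by
          rw [h1, Matrix.nonsing_inv_mul S hSu, Matrix.mul_one, Matrix.mul_one, hR]
      _ = R * S⁻¹ * A * (R * S⁻¹).transpose := by
          rw [hS, Matrix.transpose_mul]
          simp only [Matrix.mul_assoc]
  rw [hBT]
  exact h.conj _
end

section
/- Let (n_k)_{k≥1} be a strictly increasing sequence of positive integers and suppose that for every k ≥ 1 there exist N_k ≥ n_k and a symmetric matrix A_k ∈ SM(N_k, ℂ) of rank n_k such that HVC[N_k] holds for Δ_{A_k}. Then for every n ≥ 1 and every symmetric A ∈ SM(n, ℂ), VC[n] holds for Δ_A. -/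
open MvPolynomial

open Matrix in
/-- A complex symmetric matrix of rank `r` admits, for every index type of cardinality at most `r`,
a matrix of columns that are orthonormal for it. -/
theorem exists_transpose_mul_mul_eq_one {N : ℕ} {τ : Type*} [Fintype τ] [DecidableEq τ]
    (B : Matrix (Fin N) (Fin N) ℂ) (hB : B.IsSymm) (hr : Fintype.card τ ≤ B.rank) :
    ∃ U : Matrix (Fin N) τ ℂ, Uᵀ * B * U = 1 := by
  classical
  have hsymm : LinearMap.IsSymm (Matrix.toBilin' B) := ⟨fun x y => by
    simp only [Matrix.toBilin'_apply', RingHom.id_apply]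
    rw [dotProduct_comm, ← vecMul_transpose, hB.eq, ← dotProduct_mulVec]⟩
  obtain ⟨v, hv⟩ := LinearMap.BilinForm.exists_orthogonal_basis hsymm
  let b := v.reindex (finCongr (Module.finrank_fin_fun (R := ℂ) (n := N)))
  have hb : ∀ i j, i ≠ j → Matrix.toBilin' B (b i) (b j) = 0 := fun i j hij => by
    simp only [b, Module.Basis.reindex_apply]
    exact hv (fun h => hij (by simpa using h))
  let V : Matrix (Fin N) (Fin N) ℂ := (Pi.basisFun ℂ (Fin N)).toMatrix b
  let d : Fin N → ℂ := fun i => Matrix.toBilin' B (b i) (b i)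
  have hVB : ∀ i j, (Vᵀ * B * V) i j = Matrix.toBilin' B (b i) (b j) := fun i j => by
    rw [Matrix.toBilin'_apply, Matrix.mul_apply]
    simp only [Matrix.mul_apply, Finset.sum_mul]
    rw [Finset.sum_comm]
    rfl
  have hdiag : Vᵀ * B * V = Matrix.diagonal d := by
    ext i j
    rw [hVB, Matrix.diagonal_apply]
    split_ifs with h
    · subst h; rfl
    · exact hb i j h
  have hV : IsUnit V.det := by
    have := (Pi.basisFun ℂ (Fin N)).invertibleToMatrix b
    exact Matrix.isUnit_det_of_invertible V
  have hrank : B.rank = Fintype.card {i // d i ≠ 0} := by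
    rw [← Matrix.rank_diagonal, ← hdiag, Matrix.rank_mul_eq_left_of_isUnit_det _ _ hV,
      Matrix.rank_mul_eq_right_of_isUnit_det _ _ (by rwa [Matrix.det_transpose])]
  obtain ⟨g⟩ := Function.Embedding.nonempty_of_card_le (hr.trans_eq hrank)
  choose s hs using fun i => IsAlgClosed.exists_pow_nat_eq (d i) (n := 2) (by norm_num)
  refine ⟨Matrix.of fun a t => V a (g t) * (s (g t))⁻¹, ?_⟩
  ext t t'
  have key : ((Matrix.of fun a t => V a (g t) * (s (g t))⁻¹)ᵀ * B *
      (Matrix.of fun a t => V a (g t) * (s (g t))⁻¹)) t t' =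
      (Vᵀ * B * V) (g t) (g t') * ((s (g t))⁻¹ * (s (g t'))⁻¹) := by
    simp only [Matrix.mul_apply, Finset.sum_mul, Matrix.transpose_apply, Matrix.of_apply]
    refine Finset.sum_congr rfl fun _ _ => Finset.sum_congr rfl fun _ _ => by ring
  rw [key, hdiag, Matrix.diagonal_apply, Matrix.one_apply]
  by_cases h : t = t'
  · subst h
    have hne := (g t).2
    have : s (g t) ≠ 0 := fun h0 => hne (by rw [← hs, h0]; norm_num)
    rw [if_pos rfl, if_pos rfl, ← hs]
    field_simp
  · rw [if_neg h, if_neg (fun h' => h (g.injective (Subtype.ext h'))), zero_mul]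

open Matrix in
/-- Every symmetric form is the pullback of a symmetric form of at least twice its size in rank
along a left invertible matrix. -/
theorem exists_leftInverse_transpose_mul_mul_eq {N : ℕ} {κ : Type*} [Fintype κ] [DecidableEq κ]
    (B : Matrix (Fin N) (Fin N) ℂ) (hB : B.IsSymm) (C : Matrix κ κ ℂ) (hC : C.IsSymm)
    (hr : 2 * Fintype.card κ ≤ B.rank) :
    ∃ (M : Matrix (Fin N) κ ℂ) (L : Matrix κ (Fin N) ℂ), L * M = 1 ∧ Mᵀ * B * M = C := by
  obtain ⟨U, hU⟩ := exists_transpose_mul_mul_eq_one (τ := κ ⊕ κ) B hB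
    (by rw [Fintype.card_sum]; omega)
  let X : Matrix κ κ ℂ := 1 + (1 / 4 : ℂ) • C
  let Y : Matrix κ κ ℂ := Complex.I • (1 - (1 / 4 : ℂ) • C)
  have hX : Xᵀ = X := by simp [X, hC.eq]
  have hY : Yᵀ = Y := by simp [Y, hC.eq]
  refine ⟨U * Matrix.fromRows X Y,
    Matrix.fromCols ((1 / 2 : ℂ) • (1 : Matrix κ κ ℂ)) ((-Complex.I / 2) • (1 : Matrix κ κ ℂ)) *
      (Uᵀ * B), ?_, ?_⟩
  · rw [Matrix.mul_assoc, ← Matrix.mul_assoc (Uᵀ * B), hU, Matrix.one_mul,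
      Matrix.fromCols_mul_fromRows]
    simp only [Matrix.smul_mul, Matrix.one_mul, X, Y, smul_smul]
    have : -Complex.I / 2 * Complex.I = 1 / 2 := by
      linear_combination (-1 / 2 : ℂ) * Complex.I_mul_I
    rw [this]
    module
  · have : (U * Matrix.fromRows X Y)ᵀ * B * (U * Matrix.fromRows X Y) =
        (Matrix.fromRows X Y)ᵀ * (Uᵀ * B * U) * Matrix.fromRows X Y := by
      simp only [Matrix.transpose_mul, Matrix.mul_assoc]
    rw [this, hU, Matrix.mul_one, Matrix.transpose_fromRows, Matrix.fromCols_mul_fromRows, hX, hY]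
    have hYY : Y * Y = -((1 - (1 / 4 : ℂ) • C) * (1 - (1 / 4 : ℂ) • C)) := by
      simp [Y, smul_smul]
    rw [hYY]
    simp only [X, add_mul, mul_add, sub_mul, mul_sub, mul_one, one_mul]
    module

/-- The quadratic operator `∑ a_{ij} D_i D_j` for an arbitrary finite set of variables. -/
noncomputable def quadOp {σ : Type*} [Fintype σ] (A : Matrix σ σ ℂ) :
    Module.End ℂ (MvPolynomial σ ℂ) :=
  ∑ i, ∑ j, A i j • ((pderiv i).toLinearMap ∘ₗ (pderiv j).toLinearMap)

theorem quadOp_apply {σ : Type*} [Fintype σ] (A : Matrix σ σ ℂ) (f : MvPolynomial σ ℂ) :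
    quadOp A f = ∑ i, ∑ j, A i j • pderiv i (pderiv j f) := by
  simp [quadOp, LinearMap.sum_apply]

/-- The linear substitution of variables given by a matrix. -/
noncomputable def linSubst {σ τ : Type*} [Fintype τ] (M : Matrix τ σ ℂ) :
    MvPolynomial σ ℂ →ₐ[ℂ] MvPolynomial τ ℂ :=
  aeval fun i => ∑ a, M a i • X a

theorem linSubst_isHomogeneous {σ τ : Type*} [Fintype τ] (M : Matrix τ σ ℂ)
    {f : MvPolynomial σ ℂ} {d : ℕ} (hf : f.IsHomogeneous d) : (linSubst M f).IsHomogeneous d := by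
  have := hf.aeval (fun i => ∑ a, M a i • (X a : MvPolynomial τ ℂ)) (n := 1) fun i =>
    IsHomogeneous.sum _ _ _ fun a _ => by
      rw [smul_eq_C_mul]; exact (isHomogeneous_X ℂ a).C_mul _
  rwa [one_mul] at this

theorem linSubst_injective {σ τ : Type*} [Fintype σ] [Fintype τ] [DecidableEq σ]
    (M : Matrix τ σ ℂ) (L : Matrix σ τ ℂ) (h : L * M = 1) :
    Function.Injective (linSubst M) := by
  have hcomp : (linSubst L).comp (linSubst M) = AlgHom.id ℂ _ := by
    ext1 i
    simp only [linSubst, AlgHom.comp_apply, aeval_X, map_sum, map_smul, AlgHom.id_apply,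
      Finset.smul_sum, smul_smul]
    rw [Finset.sum_comm]
    simp only [← Finset.sum_smul, mul_comm (M _ _), ← Matrix.mul_apply, h, Matrix.one_apply,
      ite_smul, one_smul, zero_smul]
    simp
  exact Function.LeftInverse.injective (g := linSubst L) fun f => DFunLike.congr_fun hcomp f

theorem pderiv_linSubst {σ τ : Type*} [Fintype σ] [Fintype τ] (M : Matrix τ σ ℂ) (a : τ)
    (f : MvPolynomial σ ℂ) :
    pderiv a (linSubst M f) = ∑ i, M a i • linSubst M (pderiv i f) := by
  classical
  induction f using MvPolynomial.induction_on with
  | C r => simp [linSubst]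
  | add p q hp hq => simp only [map_add, hp, hq, smul_add, Finset.sum_add_distrib]
  | mul_X p j hp =>
    have hX : pderiv a (linSubst M (X j)) = C (M a j) := by
      simp [linSubst, Pi.single_apply, smul_eq_C_mul]
    simp only [map_mul, pderiv_mul, hp, hX, map_add, smul_add, Finset.sum_add_distrib,
      Finset.sum_mul, smul_mul_assoc, pderiv_X, Pi.single_apply]
    simp [apply_ite (linSubst M), smul_eq_C_mul, mul_comm]

open Matrix in
theorem quadOp_linSubst {σ τ : Type*} [Fintype σ] [Fintype τ] (B : Matrix τ τ ℂ)
    (M : Matrix τ σ ℂ) (f : MvPolynomial σ ℂ) :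
    quadOp B (linSubst M f) = linSubst M (quadOp (Mᵀ * B * M) f) := by
  simp only [quadOp_apply, pderiv_linSubst, map_sum, map_smul, Derivation.map_smul,
    Finset.smul_sum, smul_smul]
  have h : ∀ i j, (Mᵀ * B * M) i j = ∑ a, ∑ b, B a b * (M b j * M a i) := fun i j => by
    simp only [Matrix.mul_apply, Finset.sum_mul, Matrix.transpose_apply]
    rw [Finset.sum_comm]
    exact Finset.sum_congr rfl fun _ _ => Finset.sum_congr rfl fun _ _ => by ring
  simp only [h, Finset.sum_smul]
  calc _ = ∑ a, ∑ b, ∑ i, ∑ j, (B a b * (M b j * M a i)) • linSubst M (pderiv i (pderiv j f)) :=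
        Finset.sum_congr rfl fun _ _ => Finset.sum_congr rfl fun _ _ => Finset.sum_comm
    _ = ∑ a, ∑ i, ∑ b, ∑ j, (B a b * (M b j * M a i)) • linSubst M (pderiv i (pderiv j f)) :=
        Finset.sum_congr rfl fun _ _ => Finset.sum_comm
    _ = ∑ i, ∑ a, ∑ b, ∑ j, (B a b * (M b j * M a i)) • linSubst M (pderiv i (pderiv j f)) :=
        Finset.sum_comm
    _ = ∑ i, ∑ a, ∑ j, ∑ b, (B a b * (M b j * M a i)) • linSubst M (pderiv i (pderiv j f)) :=
        Finset.sum_congr rfl fun _ _ => Finset.sum_congr rfl fun _ _ => Finset.sum_comm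
    _ = _ := Finset.sum_congr rfl fun _ _ => Finset.sum_comm

open Matrix in
theorem quadOp_pow_linSubst {σ τ : Type*} [Fintype σ] [Fintype τ] (B : Matrix τ τ ℂ)
    (M : Matrix τ σ ℂ) (m : ℕ) (f : MvPolynomial σ ℂ) :
    (quadOp B ^ m) (linSubst M f) = linSubst M ((quadOp (Mᵀ * B * M) ^ m) f) := by
  induction m generalizing f with
  | zero => rfl
  | succ m ih => rw [pow_succ, pow_succ, Module.End.mul_apply, Module.End.mul_apply,
      quadOp_linSubst, ih]

theorem homogeneousComponent_pderiv {σ : Type*} (i : σ) (d : ℕ) (f : MvPolynomial σ ℂ) :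
    homogeneousComponent d (pderiv i f) = pderiv i (homogeneousComponent (d + 1) f) := by
  ext s
  simp only [coeff_homogeneousComponent, coeff_pderiv, map_add, Finsupp.degree_single,
    add_left_inj]
  split_ifs <;> simp

theorem homogeneousComponent_quadOp {σ : Type*} [Fintype σ] (A : Matrix σ σ ℂ) (d : ℕ)
    (f : MvPolynomial σ ℂ) :
    homogeneousComponent d (quadOp A f) = quadOp A (homogeneousComponent (d + 2) f) := by
  simp only [quadOp_apply, map_sum, map_smul, homogeneousComponent_pderiv]

theorem homogeneousComponent_quadOp_pow {σ : Type*} [Fintype σ] (A : Matrix σ σ ℂ) (d m : ℕ)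
    (f : MvPolynomial σ ℂ) :
    homogeneousComponent d ((quadOp A ^ m) f) =
      (quadOp A ^ m) (homogeneousComponent (d + 2 * m) f) := by
  induction m generalizing f with
  | zero => rfl
  | succ m ih =>
    rw [pow_succ, Module.End.mul_apply, Module.End.mul_apply, ih, homogeneousComponent_quadOp]
    rfl

theorem quadOp_pow_homogeneousComponent_eq_zero {σ : Type*} [Fintype σ] (A : Matrix σ σ ℂ)
    (d m : ℕ) (f : MvPolynomial σ ℂ) (h : (quadOp A ^ m) f = 0) :
    (quadOp A ^ m) (homogeneousComponent d f) = 0 := by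
  rw [← sum_homogeneousComponent ((quadOp A ^ m) (homogeneousComponent d f))]
  refine Finset.sum_eq_zero fun e _ => ?_
  rw [homogeneousComponent_quadOp_pow, homogeneousComponent_of_mem
    (homogeneousComponent_mem d f)]
  split_ifs with hd
  · rw [← hd, ← homogeneousComponent_quadOp_pow, h, map_zero]
  · exact map_zero _

/-- Homogenization to degree `D` with the extra variable `none`; components of degree larger
than `D` are discarded. -/
noncomputable def homogenizeTo {σ : Type*} (D : ℕ) :
    MvPolynomial σ ℂ →ₗ[ℂ] MvPolynomial (Option σ) ℂ :=
  ∑ d ∈ Finset.range (D + 1), (LinearMap.mulRight ℂ (X none ^ (D - d))) ∘ₗ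
    (rename some).toLinearMap ∘ₗ homogeneousComponent d

theorem homogenizeTo_apply {σ : Type*} (D : ℕ) (f : MvPolynomial σ ℂ) :
    homogenizeTo D f = ∑ d ∈ Finset.range (D + 1),
      rename some (homogeneousComponent d f) * X none ^ (D - d) := by
  simp [homogenizeTo, LinearMap.sum_apply]

theorem homogenizeTo_isHomogeneous {σ : Type*} (D : ℕ) (f : MvPolynomial σ ℂ) :
    (homogenizeTo D f).IsHomogeneous D := by
  rw [homogenizeTo_apply]
  refine IsHomogeneous.sum _ _ _ fun d hd => ?_
  have := (homogeneousComponent_isHomogeneous d f).rename_isHomogeneous (f := some) |>.mul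
    (isHomogeneous_X_pow (R := ℂ) (none : Option σ) (D - d))
  rwa [Nat.add_sub_cancel' (Finset.mem_range_succ_iff.1 hd)] at this

theorem homogenizeTo_of_isHomogeneous {σ : Type*} {D d : ℕ} {f : MvPolynomial σ ℂ}
    (hf : f.IsHomogeneous d) (hd : d ≤ D) :
    homogenizeTo D f = rename some f * X none ^ (D - d) := by
  rw [homogenizeTo_apply, Finset.sum_eq_single d]
  · rw [homogeneousComponent_eq_self hf]
  · intro e _ he
    rw [homogeneousComponent_of_mem hf, if_neg he, map_zero, zero_mul]
  · intro h
    exact absurd (Finset.mem_range_succ_iff.2 hd) h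

theorem homogenizeTo_mul {σ : Type*} {D E : ℕ} {f g : MvPolynomial σ ℂ}
    (hf : f.totalDegree ≤ D) (hg : g.totalDegree ≤ E) :
    homogenizeTo (D + E) (f * g) = homogenizeTo D f * homogenizeTo E g := by
  have h1 : ∀ i ∈ Finset.range (f.totalDegree + 1), ∀ j ∈ Finset.range (g.totalDegree + 1),
      homogenizeTo (D + E) (homogeneousComponent i f * homogeneousComponent j g) =
      homogenizeTo D (homogeneousComponent i f) * homogenizeTo E (homogeneousComponent j g) := by
    intro i hi j hj
    have hi' : i ≤ D := (Finset.mem_range_succ_iff.1 hi).trans hf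
    have hj' : j ≤ E := (Finset.mem_range_succ_iff.1 hj).trans hg
    rw [homogenizeTo_of_isHomogeneous (homogeneousComponent_isHomogeneous i f) hi',
      homogenizeTo_of_isHomogeneous (homogeneousComponent_isHomogeneous j g) hj',
      homogenizeTo_of_isHomogeneous ((homogeneousComponent_isHomogeneous i f).mul
        (homogeneousComponent_isHomogeneous j g)) (add_le_add hi' hj'), map_mul,
      show D + E - (i + j) = (D - i) + (E - j) by omega, pow_add]
    ring
  conv_lhs => rw [← sum_homogeneousComponent f, ← sum_homogeneousComponent g]
  conv_rhs => rw [← sum_homogeneousComponent f, ← sum_homogeneousComponent g]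
  rw [Finset.sum_mul_sum, map_sum, map_sum, map_sum, Finset.sum_mul_sum]
  refine Finset.sum_congr rfl fun i hi => ?_
  rw [map_sum]
  exact Finset.sum_congr rfl fun j hj => h1 i hi j hj

theorem homogenizeTo_pow {σ : Type*} {D : ℕ} {f : MvPolynomial σ ℂ} (hf : f.totalDegree ≤ D)
    (m : ℕ) : homogenizeTo (m * D) (f ^ m) = homogenizeTo D f ^ m := by
  induction m with
  | zero => simp [homogenizeTo_of_isHomogeneous (isHomogeneous_one σ ℂ)]
  | succ m ih =>
    rw [pow_succ, pow_succ, ← ih, Nat.succ_mul, homogenizeTo_mul _ hf]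
    exact (totalDegree_pow f m).trans (Nat.mul_le_mul_left m hf)

/-- The matrix `A` bordered by a zero row and column. -/
def borderZero {σ : Type*} (A : Matrix σ σ ℂ) : Matrix (Option σ) (Option σ) ℂ :=
  fun i j => i.elim 0 fun i => j.elim 0 fun j => A i j

theorem quadOp_borderZero {σ : Type*} [Fintype σ] (A : Matrix σ σ ℂ) (k : ℕ)
    (f : MvPolynomial σ ℂ) :
    quadOp (borderZero A) (rename some f * X none ^ k) =
      rename some (quadOp A f) * X none ^ k := by
  have h : ∀ (i : σ) (f : MvPolynomial σ ℂ), pderiv (some i) (rename some f * X none ^ k) =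
      rename some (pderiv i f) * X none ^ k := fun i f => by
    rw [pderiv_mul, pderiv_rename (Option.some_injective σ), pderiv_pow,
      pderiv_X_of_ne (by simp), mul_zero, mul_zero, add_zero]
  simp only [quadOp_apply, Fintype.sum_option, borderZero, h, map_sum, Finset.sum_mul,
    Option.elim_none, Option.elim_some, zero_smul, Finset.sum_const_zero, zero_add, map_smul,
    smul_mul_assoc]

theorem quadOp_pow_borderZero {σ : Type*} [Fintype σ] (A : Matrix σ σ ℂ) (k m : ℕ)
    (f : MvPolynomial σ ℂ) :
    (quadOp (borderZero A) ^ m) (rename some f * X none ^ k) =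
      rename some ((quadOp A ^ m) f) * X none ^ k := by
  induction m generalizing f with
  | zero => rfl
  | succ m ih => rw [pow_succ, pow_succ, Module.End.mul_apply, Module.End.mul_apply,
      quadOp_borderZero, ih]

theorem quadOp_pow_borderZero_homogenizeTo {σ : Type*} [Fintype σ] (A : Matrix σ σ ℂ) (D m : ℕ)
    (f : MvPolynomial σ ℂ) :
    (quadOp (borderZero A) ^ m) (homogenizeTo D f) = ∑ d ∈ Finset.range (D + 1),
      rename some ((quadOp A ^ m) (homogeneousComponent d f)) * X none ^ (D - d) := by
  simp only [homogenizeTo_apply, map_sum, quadOp_pow_borderZero]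

/-- The bordered operator kills the homogenization exactly when the operator kills the
polynomial. -/
theorem quadOp_pow_borderZero_homogenizeTo_eq_zero_iff {σ : Type*} [Fintype σ]
    (A : Matrix σ σ ℂ) {D : ℕ} (m : ℕ) {f : MvPolynomial σ ℂ} (hf : f.totalDegree ≤ D) :
    (quadOp (borderZero A) ^ m) (homogenizeTo D f) = 0 ↔ (quadOp A ^ m) f = 0 := by
  rw [quadOp_pow_borderZero_homogenizeTo]
  refine ⟨fun h => ?_, fun h => Finset.sum_eq_zero fun d _ => by
    rw [quadOp_pow_homogeneousComponent_eq_zero A d m f h, map_zero, zero_mul]⟩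
  have h' := congrArg (aeval (R := ℂ)
    fun o : Option σ => o.elim (1 : MvPolynomial σ ℂ) X) h
  simp only [map_sum, map_mul, map_pow, aeval_X, aeval_rename, map_zero, Option.elim_none, one_pow,
    mul_one] at h'
  have hid : ∀ p : MvPolynomial σ ℂ,
      aeval ((fun o : Option σ => o.elim (1 : MvPolynomial σ ℂ) X) ∘ some) p = p :=
    fun p => aeval_X_left_apply p
  simp only [hid] at h'
  rw [← map_sum] at h'
  convert h'
  conv_lhs => rw [← sum_homogeneousComponent f]
  refine Finset.sum_subset (Finset.range_subset_range.2 (by omega)) fun d _ hd => ?_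
  exact homogeneousComponent_eq_zero _ _ (by simpa using hd)

/-- If along a strictly increasing sequence of ranks `n_k` there are symmetric matrices
`A_k ∈ SM(N_k, ℂ)` of rank `n_k` (with `N_k ≥ n_k`) such that `HVC[N_k]` holds for
`Δ_{A_k}`, then `VC[n]` holds for all `Δ_A` with `A` symmetric. -/
theorem stmt7 (nseq : ℕ → ℕ) (hpos : ∀ k, 1 ≤ nseq k) (hmono : StrictMono nseq)
    (h : ∀ k : ℕ, ∃ N : ℕ, nseq k ≤ N ∧ ∃ A : Matrix (Fin N) (Fin N) ℂ,
          A.IsSymm ∧ A.rank = nseq k ∧ HVC (Delta A)) :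
    ∀ n : ℕ, 1 ≤ n → ∀ A : Matrix (Fin n) (Fin n) ℂ, A.IsSymm → VC (Delta A) := by
  intro n _ A hA P hP
  obtain ⟨N, _, B, hB, hrank, hHVC⟩ := h (2 * (n + 1))
  have hC : (borderZero A).IsSymm := by
    ext i j
    cases i <;> cases j <;> simp [borderZero, hA.apply]
  obtain ⟨M, L, hLM, hM⟩ := exists_leftInverse_transpose_mul_mul_eq B hB (borderZero A) hC (by
    rw [hrank, Fintype.card_option, Fintype.card_fin]
    exact hmono.le_apply)
  have key : ∀ m k, (Delta B ^ m) (linSubst M (homogenizeTo P.totalDegree P) ^ k) = 0 ↔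
      (Delta A ^ m) (P ^ k) = 0 := fun m k => by
    change (quadOp B ^ m) _ = 0 ↔ (quadOp A ^ m) _ = 0
    rw [← map_pow, quadOp_pow_linSubst, hM, map_eq_zero_iff _ (linSubst_injective M L hLM),
      ← homogenizeTo_pow le_rfl,
      quadOp_pow_borderZero_homogenizeTo_eq_zero_iff _ _ (totalDegree_pow P k)]
  obtain ⟨K, hK⟩ := hHVC (linSubst M (homogenizeTo P.totalDegree P))
    ⟨_, linSubst_isHomogeneous M (homogenizeTo_isHomogeneous _ P)⟩
    fun m hm => (key m m).2 (hP m hm)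
  exact ⟨K, fun m hm => (key m (m + 1)).1 (hK m hm)⟩
end

section
/- Let A ∈ SM(n, ℂ) of rank r ≥ 1 and let U ∈ GL(n, ℂ) be such that A = U·(I_r ⊕ 0)·U^T, where I_r ⊕ 0 is the diagonal matrix with r ones followed by zeros. Then a polynomial P ∈ ℂ[z_1, …, z_n] is Δ_A-nilpotent if and only if the r×r upper-left submatrix of U^T·Hes(P)·U is a nilpotent matrix over ℂ[z]. In particular, when r = n (Δ_A full rank), P is Δ_A-nilpotent if and only if U^T·Hes(P)·U is nilpotent. -/
open MvPolynomial

/-- The Hessian matrix of a polynomial. -/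
noncomputable def Hes {n : ℕ} (P : MvPolynomial (Fin n) ℂ) :
    Matrix (Fin n) (Fin n) (MvPolynomial (Fin n) ℂ) :=
  Matrix.of fun i j => pderiv i (pderiv j P)

theorem Matrix.eq_zero_of_isIdempotentElem_of_trace_eq_zero {K m : Type*} [Field K] [CharZero K]
    [Fintype m] [DecidableEq m] {e : Matrix m m K} (he : IsIdempotentElem e)
    (htr : e.trace = 0) : e = 0 := by
  have hf : IsIdempotentElem (Matrix.toLin' e) := by
    rw [IsIdempotentElem, Module.End.mul_eq_comp, ← Matrix.toLin'_mul, he.eq]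
  have h := LinearMap.IsIdempotentElem.isProj_range _ hf
  have := h.trace
  rw [Matrix.trace_toLin'_eq, htr] at this
  have h0 : LinearMap.range (Matrix.toLin' e) = ⊥ := by
    apply Submodule.finrank_eq_zero.mp
    exact_mod_cast this.symm
  rw [LinearMap.range_eq_bot] at h0
  simpa using h0

open Polynomial in
theorem Matrix.trace_aeval_X_mul_eq_zero {K m : Type*} [CommRing K]
    [Fintype m] [DecidableEq m] {M : Matrix m m K} (h : ∀ j, 1 ≤ j → (M ^ j).trace = 0)
    (g : K[X]) : (aeval M (Polynomial.X * g)).trace = 0 := by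
  induction g using Polynomial.induction_on' with
  | add p q hp hq => rw [mul_add, map_add, Matrix.trace_add, hp, hq, add_zero]
  | monomial n a =>
    rw [Polynomial.X_mul_monomial, Polynomial.aeval_monomial, ← Algebra.smul_def,
      Matrix.trace_smul, h _ n.succ_pos, smul_zero]

open Polynomial in
theorem Matrix.isNilpotent_of_trace_pow_eq_zero_of_field {K m : Type*} [Field K] [CharZero K]
    [Fintype m] [DecidableEq m] {M : Matrix m m K} (h : ∀ j, 1 ≤ j → (M ^ j).trace = 0) :
    IsNilpotent M := by
  obtain ⟨q, hpq, hq⟩ := Polynomial.exists_eq_pow_rootMultiplicity_mul_and_not_dvd M.charpoly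
    M.charpoly_monic.ne_zero 0
  set a := M.charpoly.rootMultiplicity 0
  rw [map_zero, sub_zero] at hpq hq
  have hcop : IsCoprime (Polynomial.X ^ (a + 1) : K[X]) q :=
    ((Polynomial.prime_X.irreducible.coprime_iff_not_dvd).mpr hq).pow_left
  obtain ⟨u, v, huv⟩ := hcop
  have hp0 : aeval M (Polynomial.X ^ a * q) = 0 := by rw [← hpq, M.aeval_self_charpoly]
  have hsum : aeval M (u * Polynomial.X ^ (a + 1)) + aeval M (v * q) = 1 := by
    rw [← map_add, huv, map_one]
  have hprod : aeval M (u * Polynomial.X ^ (a + 1)) * aeval M (v * q) = 0 := by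
    rw [← map_mul, show u * Polynomial.X ^ (a + 1) * (v * q) =
      u * Polynomial.X * v * (Polynomial.X ^ a * q) by ring, map_mul, hp0, mul_zero]
  have he : aeval M (u * Polynomial.X ^ (a + 1)) = 0 := by
    refine Matrix.eq_zero_of_isIdempotentElem_of_trace_eq_zero ?_ ?_
    · rw [← eq_sub_iff_add_eq'] at hsum
      rw [hsum, mul_sub, mul_one, sub_eq_zero] at hprod
      exact hprod.symm
    · rw [show u * Polynomial.X ^ (a + 1) = Polynomial.X * (u * Polynomial.X ^ a) by ring]
      exact Matrix.trace_aeval_X_mul_eq_zero h _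
  refine ⟨a, ?_⟩
  rw [he, zero_add] at hsum
  calc M ^ a = aeval M (Polynomial.X ^ a * (v * q)) := by
        rw [map_mul, hsum, mul_one, map_pow, Polynomial.aeval_X]
    _ = 0 := by rw [mul_left_comm, map_mul, hp0, mul_zero]

/-- Over a domain of characteristic zero, a matrix is nilpotent iff all its positive powers
are traceless. -/
theorem Matrix.isNilpotent_iff_trace_pow_eq_zero {R m : Type*} [CommRing R] [IsDomain R]
    [CharZero R] [Fintype m] [DecidableEq m] (M : Matrix m m R) :
    IsNilpotent M ↔ ∀ j, 1 ≤ j → (M ^ j).trace = 0 := by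
  refine ⟨fun h j hj => (Matrix.isNilpotent_trace_of_isNilpotent
    (h.pow_of_pos (Nat.one_le_iff_ne_zero.mp hj))).eq_zero, fun h => ?_⟩
  let φ := algebraMap R (FractionRing R)
  have hφ : Function.Injective φ := IsFractionRing.injective R (FractionRing R)
  have : CharZero (FractionRing R) := charZero_of_injective_algebraMap hφ
  rw [← IsNilpotent.map_iff (f := φ.mapMatrix) (Matrix.map_injective hφ)]
  refine Matrix.isNilpotent_of_trace_pow_eq_zero_of_field fun j hj => ?_
  rw [← map_pow, RingHom.mapMatrix_apply, ← AddMonoidHom.map_trace, h j hj, map_zero]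

open scoped PowerSeries

/-- The coefficientwise extension of a derivation to power series. -/
noncomputable def Derivation.powerSeries {K R : Type*} [CommRing K] [CommRing R] [Algebra K R]
    (D : Derivation K R R) : Derivation K R⟦X⟧ R⟦X⟧ :=
  Derivation.mk'
    { toFun := fun f => PowerSeries.mk fun n => D (PowerSeries.coeff n f)
      map_add' := fun f g => by ext; simp
      map_smul' := fun c f => by ext; simp }
    (fun f g => by
      ext n
      simp only [LinearMap.coe_mk, AddHom.coe_mk, PowerSeries.coeff_mk, PowerSeries.coeff_mul,
        map_sum, Derivation.leibniz, smul_eq_mul, map_add, Finset.sum_add_distrib, mul_comm g]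
      congr 1
      exact Finset.sum_congr rfl fun _ _ => mul_comm _ _)

section
variable {K R : Type*} [CommRing K] [CommRing R] [Algebra K R]

@[simp]
theorem Derivation.coeff_powerSeries (D : Derivation K R R) (f : R⟦X⟧) (n : ℕ) :
    PowerSeries.coeff n (D.powerSeries f) = D (PowerSeries.coeff n f) := by
  simp [Derivation.powerSeries]

theorem Derivation.X_pow_dvd_powerSeries (D : Derivation K R R) {f : R⟦X⟧} {N : ℕ}
    (h : (PowerSeries.X : R⟦X⟧) ^ N ∣ f) : (PowerSeries.X : R⟦X⟧) ^ N ∣ D.powerSeries f := by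
  rw [PowerSeries.X_pow_dvd_iff] at h ⊢
  intro d hd
  rw [D.coeff_powerSeries, h d hd, map_zero]

theorem Derivation.powerSeries_comm {D E : Derivation K R R} (h : ∀ x, D (E x) = E (D x))
    (f : R⟦X⟧) : D.powerSeries (E.powerSeries f) = E.powerSeries (D.powerSeries f) := by
  ext; simp [h]

theorem Derivation.derivative_powerSeries (D : Derivation K R R) (f : R⟦X⟧) :
    PowerSeries.derivative R (D.powerSeries f) = D.powerSeries (PowerSeries.derivative R f) := by
  ext n
  simp only [PowerSeries.coeff_derivative, coeff_powerSeries, Derivation.leibniz]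
  simp [mul_comm]

theorem PowerSeries.X_pow_succ_dvd_of_derivative [IsDomain R] [CharZero R]
    {f : R⟦X⟧} {N : ℕ} (h : (X : R⟦X⟧) ^ N ∣ derivative R f) (h0 : coeff 0 f = 0) :
    (X : R⟦X⟧) ^ (N + 1) ∣ f := by
  rw [X_pow_dvd_iff] at h ⊢
  rintro (_ | d) hd
  · exact h0
  · have := h d (by omega)
    rw [coeff_derivative] at this
    exact (mul_eq_zero.mp this).resolve_right (by exact_mod_cast d.succ_ne_zero)

theorem PowerSeries.coeff_mul_of_X_pow_dvd {f g : R⟦X⟧} {N d : ℕ} (h : (X : R⟦X⟧) ^ N ∣ g)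
    (hd : d < N) : coeff d (f * g) = 0 :=
  X_pow_dvd_iff.mp (h.mul_left f) d hd

theorem Derivation.map_matrix_pow_of_eq {m : Type*} [Fintype m] [DecidableEq m]
    (L : Derivation K R R) {H : Matrix m m R} (hL : H.map L = (2 : R) • H ^ 2) (j : ℕ) :
    (H ^ j).map L = (2 * j : R) • H ^ (j + 1) := by
  have hmul (A B : Matrix m m R) : (A * B).map L = A * B.map L + A.map L * B := by
    ext i k
    simp [Matrix.mul_apply, Finset.sum_add_distrib, mul_comm]
  induction j with
  | zero =>
    ext i k
    by_cases hik : i = k <;> simp [hik]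
  | succ j ih =>
    rw [pow_succ, hmul, ih, hL, Matrix.mul_smul, Matrix.smul_mul, ← pow_add, ← pow_succ,
      ← add_smul]
    congr 1
    push_cast; ring

theorem Derivation.trace_pow_of_eq {m : Type*} [Fintype m] [DecidableEq m]
    (L : Derivation K R R) {H : Matrix m m R} (hL : H.map L = (2 : R) • H ^ 2) (j : ℕ) :
    L (H ^ j).trace = (2 * j : R) * (H ^ (j + 1)).trace := by
  rw [← smul_eq_mul, ← Matrix.trace_smul, ← L.map_matrix_pow_of_eq hL]
  simp [Matrix.trace, map_sum]

end

/-- The sum of the squares of a family of derivations, as a linear operator. -/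
noncomputable def laplacian {K R ι : Type*} [Fintype ι] [CommRing K] [CommRing R] [Algebra K R]
    (D : ι → Derivation K R R) : Module.End K R :=
  ∑ i, (D i).toLinearMap ∘ₗ (D i).toLinearMap

/-- The matrix of second derivatives of an element. -/
def hessian {K R ι : Type*} [CommRing K] [CommRing R] [Algebra K R]
    (D : ι → Derivation K R R) (P : R) : Matrix ι ι R :=
  Matrix.of fun i j => D i (D j P)

section
variable {K R ι : Type*} [Fintype ι] [CommRing K] [CommRing R] [Algebra K R]
  (D : ι → Derivation K R R)

theorem laplacian_apply (P : R) : laplacian D P = ∑ i, D i (D i P) := by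
  simp [laplacian]

theorem trace_hessian (P : R) : (hessian D P).trace = laplacian D P := by
  simp [laplacian, hessian, Matrix.trace]

theorem coeff_laplacian_powerSeries (f : R⟦X⟧) (n : ℕ) :
    PowerSeries.coeff n (laplacian (fun i => (D i).powerSeries) f) =
      laplacian D (PowerSeries.coeff n f) := by
  simp [laplacian_apply]

theorem laplacian_pow (P : R) (k : ℕ) :
    laplacian D (P ^ (k + 2)) = (k + 2 : R) *
      ((k + 1 : R) * P ^ k * ∑ i, D i P ^ 2 + P ^ (k + 1) * laplacian D P) := by
  simp only [laplacian_apply, Finset.mul_sum, ← Finset.sum_add_distrib]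
  refine Finset.sum_congr rfl fun i _ => ?_
  simp only [Derivation.leibniz_pow, Derivation.leibniz, smul_eq_mul, nsmul_eq_mul,
    Derivation.map_natCast, Nat.add_sub_cancel, show k + 2 - 1 = k + 1 from rfl]
  push_cast
  ring

variable {D}

theorem Derivation.sub_sum_smul_apply (T : Derivation K R R) (a : ι → R) (x : R) :
    (T - ∑ i, a i • D i) x = T x - ∑ i, a i * D i x := by
  rw [Derivation.sub_apply, ← Derivation.coeFnAddMonoidHom_apply (∑ i, a i • D i), map_sum,
    Finset.sum_apply]
  rfl

/-- If `T Q = ∑ (D i Q)²`, the Hessian of `Q` satisfies a matrix Riccati equation along the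
derivation `T - ∑ 2 (D i Q) D i`. -/
theorem hessian_map_transport [DecidableEq ι]
    (hD : ∀ i j x, D i (D j x) = D j (D i x)) {T : Derivation K R R}
    (hT : ∀ i x, T (D i x) = D i (T x)) {Q : R} (hQ : T Q = ∑ i, D i Q ^ 2) :
    (hessian D Q).map (T - ∑ i, (2 * D i Q) • D i) = (2 : R) • hessian D Q ^ 2 := by
  ext k l
  have h : T (D k (D l Q)) =
      ∑ i, (2 * D i Q * D i (D k (D l Q)) + 2 * (D k (D i Q) * D i (D l Q))) := by
    rw [hT, hT, hQ]
    simp only [map_sum]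
    refine Finset.sum_congr rfl fun i _ => ?_
    simp only [Derivation.leibniz_pow, Derivation.leibniz, smul_eq_mul, nsmul_eq_mul,
      Derivation.map_natCast]
    rw [hD i k, hD i l, hD k l]
    ring_nf
  simp only [hessian, Matrix.map_apply, Matrix.of_apply, h, Derivation.sub_sum_smul_apply,
    Finset.sum_add_distrib, add_sub_cancel_left, Matrix.smul_apply, smul_eq_mul, sq,
    Matrix.mul_apply, Finset.mul_sum]

end

/-- The Taylor coefficients of the solution `Q` of `∂Q/∂t = ∑ (D i Q)²`, `Q(0) = P`. -/
noncomputable def burgersCoeff {K R ι : Type*} [Fintype ι] [Field K] [CommRing R] [Algebra K R]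
    (D : ι → Derivation K R R) (P : R) : ℕ → R
  | 0 => P
  | n + 1 => ((n + 1 : K)⁻¹) • ∑ i, ∑ p ∈ (Finset.HasAntidiagonal.antidiagonal n).attach,
      D i (burgersCoeff D P p.1.1) * D i (burgersCoeff D P p.1.2)
  decreasing_by
  all_goals
    have := Finset.HasAntidiagonal.mem_antidiagonal.mp p.2
    omega

theorem exists_powerSeries_derivative_eq {K R ι : Type*} [Fintype ι] [Field K] [CharZero K]
    [CommRing R] [Algebra K R] (D : ι → Derivation K R R) (P : R) :
    ∃ Q : R⟦X⟧, PowerSeries.coeff 0 Q = P ∧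
      PowerSeries.derivative R Q = ∑ i, (D i).powerSeries Q ^ 2 := by
  refine ⟨PowerSeries.mk (burgersCoeff D P), by rw [PowerSeries.coeff_mk, burgersCoeff], ?_⟩
  ext n
  have hn : (n + 1 : R) = algebraMap K R (n + 1) := by simp
  have hn' : (n + 1 : K) ≠ 0 := by exact_mod_cast n.succ_ne_zero
  rw [PowerSeries.coeff_derivative, PowerSeries.coeff_mk, burgersCoeff, hn, mul_comm,
    ← Algebra.smul_def, smul_inv_smul₀ hn', map_sum]
  refine Finset.sum_congr rfl fun i _ => ?_
  rw [sq, PowerSeries.coeff_mul]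
  simp only [Derivation.coeff_powerSeries, PowerSeries.coeff_mk]
  exact Finset.sum_attach (Finset.HasAntidiagonal.antidiagonal n)
    fun p => D i (burgersCoeff D P p.1) * D i (burgersCoeff D P p.2)

section
variable {K R ι : Type*} [Fintype ι] [CommRing R]

open PowerSeries in
/-- If `∂u j/∂t` agrees with a nonzero multiple of `u (j + 1)` up to a combination of
derivatives of `u j`, and `u 1, …, u (N - 1)` vanish at `t = 0`, then `u 1` vanishes to order
`N - 1`, and its next coefficient is a nonzero multiple of the value of `u N` at `t = 0`. -/
theorem X_pow_dvd_and_coeff_eq_zero_iff [IsDomain R] [CharZero R] [CommRing K] [Algebra K R]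
    (D : ι → Derivation K R R) {u : ℕ → R⟦X⟧} {b : ι → R⟦X⟧}
    (hu : ∀ j, derivative R (u j) - ∑ i, b i * (D i).powerSeries (u j) =
      (2 * j : R⟦X⟧) * u (j + 1)) {N : ℕ} (h0 : ∀ j, 1 ≤ j → j < N → coeff 0 (u j) = 0)
    (d : ℕ) : ∀ j, 1 ≤ j → j + d = N →
      (X : R⟦X⟧) ^ d ∣ u j ∧ (coeff d (u j) = 0 ↔ coeff 0 (u N) = 0) := by
  have hdvd (d : ℕ) : ∀ j, 1 ≤ j → j + d ≤ N → (X : R⟦X⟧) ^ d ∣ u j := by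
    induction d with
    | zero => simp
    | succ d ih =>
      intro j hj hjd
      refine X_pow_succ_dvd_of_derivative ?_ (h0 j hj (by omega))
      rw [sub_eq_iff_eq_add.mp (hu j)]
      exact dvd_add ((ih (j + 1) (by omega) (by omega)).mul_left _) (Finset.dvd_sum fun i _ =>
        ((D i).X_pow_dvd_powerSeries (ih j hj (by omega))).mul_left _)
  intro j hj hjd
  refine ⟨hdvd d j hj hjd.le, ?_⟩
  induction d generalizing j with
  | zero => rw [← hjd, add_zero]
  | succ d ih =>
    rw [← ih (j + 1) (by omega) (by omega)]
    have h := congrArg (coeff d) (hu j)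
    have hz : coeff d (∑ i, b i * (D i).powerSeries (u j)) = 0 := by
      rw [map_sum]
      exact Finset.sum_eq_zero fun i _ => coeff_mul_of_X_pow_dvd
        ((D i).X_pow_dvd_powerSeries (hdvd _ j hj hjd.le)) d.lt_succ_self
    rw [map_sub, hz, sub_zero, coeff_derivative,
      show (2 * j : R⟦X⟧) = PowerSeries.C (2 * j : R) by
        rw [map_mul, map_natCast, map_ofNat], PowerSeries.coeff_C_mul] at h
    have h1 : (d + 1 : R) ≠ 0 := by exact_mod_cast d.succ_ne_zero
    have h2 : (2 * j : R) ≠ 0 := mul_ne_zero two_ne_zero (by exact_mod_cast (by omega : j ≠ 0))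
    rw [← mul_eq_zero_iff_right h1, h, mul_eq_zero_iff_left h2]

open PowerSeries in
/-- Where `Δ Q` vanishes to order `M`, the coefficients of powers of `Q` up to order `M` are
nonzero multiples of iterated Laplacians of powers of `Q(0)`. -/
theorem exists_smul_coeff_eq [Field K] [CharZero K] [Algebra K R]
    (D : ι → Derivation K R R) {Q : R⟦X⟧}
    (hQ : derivative R Q = ∑ i, (D i).powerSeries Q ^ 2) {M : ℕ}
    (hM : (X : R⟦X⟧) ^ M ∣ laplacian (fun i => (D i).powerSeries) Q) (d : ℕ) :
    ∀ k, d ≤ M → ∃ c : K, c ≠ 0 ∧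
      coeff d (Q ^ (k + 1)) = c • (laplacian D ^ d) (coeff 0 Q ^ (k + 1 + d)) := by
  induction d with
  | zero => exact fun k _ => ⟨1, one_ne_zero, by simp⟩
  | succ d ih =>
    intro k hd
    obtain ⟨c, hc, h⟩ := ih (k + 1) (by omega)
    have h1 : (d + 1 : K) ≠ 0 := by exact_mod_cast d.succ_ne_zero
    have h2 : (k + 2 : K) ≠ 0 := by exact_mod_cast (k + 1).succ_ne_zero
    refine ⟨((k + 2) * (d + 1) : K)⁻¹ * c,
      mul_ne_zero (inv_ne_zero (mul_ne_zero h2 h1)) hc, ?_⟩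
    have hL := congrArg (coeff d) (laplacian_pow (fun i => (D i).powerSeries) Q k)
    rw [← hQ, show (k + 2 : R⟦X⟧) = PowerSeries.C (k + 2 : R) by
        rw [map_add, map_natCast, map_ofNat], PowerSeries.coeff_C_mul, map_add,
      coeff_mul_of_X_pow_dvd hM (by omega), add_zero, coeff_laplacian_powerSeries, h,
      show (k + 1 : R⟦X⟧) * Q ^ k * derivative R Q = derivative R (Q ^ (k + 1)) by
        rw [Derivation.leibniz_pow]; simp [mul_assoc], coeff_derivative] at hL
    have hL' : c • (laplacian D ^ (d + 1)) (coeff 0 Q ^ (k + 1 + (d + 1))) =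
        ((k + 2) * (d + 1) : K) • coeff (d + 1) (Q ^ (k + 1)) := by
      rw [pow_succ', Module.End.mul_apply, ← map_smul,
        show k + 1 + (d + 1) = k + 1 + 1 + d by ring, hL, Algebra.smul_def]
      simp only [map_mul, map_add, map_natCast, map_one, map_ofNat]
      ring
    rw [mul_smul, hL', inv_smul_smul₀ (mul_ne_zero h2 h1)]

variable [IsDomain R] [CharZero R] [DecidableEq ι] [Field K] [CharZero K] [Algebra K R]
  {D : ι → Derivation K R R}

open PowerSeries in
/-- If the traces of the lower powers of the Hessian of `P` vanish, then `Δ ^ N (P ^ N)` vanishes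
iff the trace of the `N`-th power does. -/
theorem laplacian_pow_eq_zero_iff_trace_hessian_pow_eq_zero
    (hD : ∀ i j x, D i (D j x) = D j (D i x)) (P : R) {N : ℕ} (hN : 1 ≤ N)
    (h0 : ∀ j, 1 ≤ j → j < N → (hessian D P ^ j).trace = 0) :
    (laplacian D ^ N) (P ^ N) = 0 ↔ (hessian D P ^ N).trace = 0 := by
  obtain ⟨Q, rfl, hQ⟩ := exists_powerSeries_derivative_eq D P
  let E i := (D i).powerSeries
  have hcoeff (j : ℕ) :
      coeff 0 (hessian E Q ^ j).trace = (hessian D (coeff 0 Q) ^ j).trace := by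
    rw [coeff_zero_eq_constantCoeff_apply,
      AddMonoidHom.map_trace (PowerSeries.constantCoeff (R := R)),
      ← RingHom.mapMatrix_apply, map_pow]
    congr 2
    ext i k
    simp only [hessian, E, RingHom.mapMatrix_apply, Matrix.map_apply, Matrix.of_apply,
      ← coeff_zero_eq_constantCoeff_apply, Derivation.coeff_powerSeries]
  have hu (j : ℕ) := Derivation.trace_pow_of_eq _ (hessian_map_transport (D := E)
    (T := (derivative R).restrictScalars K)
    (fun i k x => Derivation.powerSeries_comm (hD i k) x)
    (fun i x => (D i).derivative_powerSeries x) hQ) j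
  simp only [Derivation.sub_sum_smul_apply] at hu
  obtain ⟨hdvd, hiff⟩ := X_pow_dvd_and_coeff_eq_zero_iff D hu (N := N)
    (fun j hj hjN => (hcoeff j).trans (h0 j hj hjN)) (N - 1) 1 le_rfl (by omega)
  rw [pow_one, trace_hessian] at hdvd hiff
  obtain ⟨c, hc, h⟩ := exists_smul_coeff_eq D hQ hdvd (N - 1) 0 le_rfl
  rw [← hcoeff, ← hiff, coeff_laplacian_powerSeries]
  rw [zero_add, pow_one, Nat.add_sub_cancel' hN] at h
  rw [h, map_smul, smul_eq_zero_iff_right hc, ← Module.End.mul_apply, ← pow_succ',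
    Nat.sub_add_cancel hN]

/-- For commuting derivations `D i`, all `Δ ^ m (P ^ m)` with `m ≥ 1` vanish iff the Hessian
of `P` is nilpotent. -/
theorem forall_laplacian_pow_eq_zero_iff_isNilpotent_hessian
    (hD : ∀ i j x, D i (D j x) = D j (D i x)) (P : R) :
    (∀ m, 1 ≤ m → (laplacian D ^ m) (P ^ m) = 0) ↔ IsNilpotent (hessian D P) := by
  rw [Matrix.isNilpotent_iff_trace_pow_eq_zero]
  refine ⟨fun h j => ?_, fun h m hm =>
    (laplacian_pow_eq_zero_iff_trace_hessian_pow_eq_zero hD P hm fun j hj _ => h j hj).mpr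
      (h m hm)⟩
  induction j using Nat.strong_induction_on with
  | _ j ih =>
    intro hj
    exact (laplacian_pow_eq_zero_iff_trace_hessian_pow_eq_zero hD P hj
      fun i hi hij => ih i hij hi).mp (h j hj)

end

theorem pderiv_pderiv_comm {n : ℕ} (i j : Fin n) (P : MvPolynomial (Fin n) ℂ) :
    pderiv i (pderiv j P) = pderiv j (pderiv i P) := by
  have h : ⁅(pderiv i : Derivation ℂ (MvPolynomial (Fin n) ℂ) (MvPolynomial (Fin n) ℂ)),
      (pderiv j : Derivation ℂ (MvPolynomial (Fin n) ℂ) (MvPolynomial (Fin n) ℂ))⁆ = 0 := by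
    refine MvPolynomial.derivation_ext fun k => ?_
    classical
    simp only [Derivation.commutator_apply, pderiv_X, Pi.single_apply]
    split_ifs <;> simp
  have := Derivation.congr_fun h P
  simpa [Derivation.commutator_apply, sub_eq_zero] using this

/-- The partial derivatives along the columns of `V`. -/
noncomputable def columnDeriv {n r : ℕ} (V : Matrix (Fin n) (Fin r) ℂ) (k : Fin r) :
    Derivation ℂ (MvPolynomial (Fin n) ℂ) (MvPolynomial (Fin n) ℂ) :=
  ∑ i, V i k • pderiv i

section
variable {n r : ℕ} (V : Matrix (Fin n) (Fin r) ℂ)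

theorem columnDeriv_apply (k : Fin r) (P : MvPolynomial (Fin n) ℂ) :
    columnDeriv V k P = ∑ i, V i k • pderiv i P := by
  rw [columnDeriv, ← Derivation.coeFnAddMonoidHom_apply, map_sum, Finset.sum_apply]
  rfl

theorem columnDeriv_columnDeriv (k l : Fin r) (P : MvPolynomial (Fin n) ℂ) :
    columnDeriv V k (columnDeriv V l P) =
      ∑ i, ∑ j, (V i k * V j l) • pderiv i (pderiv j P) := by
  simp only [columnDeriv_apply, map_sum, Derivation.map_smul, Finset.smul_sum, smul_smul]
  rw [Finset.sum_comm]
  refine Finset.sum_congr rfl fun i _ => Finset.sum_congr rfl fun j _ => ?_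
  rw [mul_comm]

theorem columnDeriv_comm (k l : Fin r) (P : MvPolynomial (Fin n) ℂ) :
    columnDeriv V k (columnDeriv V l P) = columnDeriv V l (columnDeriv V k P) := by
  rw [columnDeriv_columnDeriv, columnDeriv_columnDeriv, Finset.sum_comm]
  refine Finset.sum_congr rfl fun i _ => Finset.sum_congr rfl fun j _ => ?_
  rw [pderiv_pderiv_comm, mul_comm]

theorem laplacian_columnDeriv : laplacian (columnDeriv V) = Delta (V * V.transpose) := by
  refine LinearMap.ext fun P => ?_
  simp only [laplacian_apply, columnDeriv_columnDeriv, Delta, LinearMap.sum_apply,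
    LinearMap.smul_apply, LinearMap.comp_apply, Derivation.coeFn_coe, Matrix.mul_apply,
    Matrix.transpose_apply, Finset.sum_smul]
  rw [Finset.sum_comm]
  exact Finset.sum_congr rfl fun i _ => Finset.sum_comm

theorem hessian_columnDeriv (P : MvPolynomial (Fin n) ℂ) :
    hessian (columnDeriv V) P = (V.transpose.map fun a => (C a : MvPolynomial (Fin n) ℂ)) *
      Hes P * (V.map fun a => (C a : MvPolynomial (Fin n) ℂ)) := by
  ext1 k l
  simp only [hessian, Matrix.of_apply, columnDeriv_columnDeriv, Hes, Matrix.mul_apply,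
    Matrix.map_apply, Matrix.transpose_apply, Finset.sum_mul]
  rw [Finset.sum_comm]
  refine Finset.sum_congr rfl fun i _ => Finset.sum_congr rfl fun j _ => ?_
  rw [smul_eq_C_mul, C_mul]
  ring

end

theorem mul_diagonal_mul_transpose_eq_submatrix {n r : ℕ} (hrn : r ≤ n)
    (U : Matrix (Fin n) (Fin n) ℂ) :
    U * Matrix.diagonal (fun i : Fin n => if (i : ℕ) < r then (1 : ℂ) else 0) * U.transpose =
      U.submatrix id (Fin.castLE hrn) * (U.submatrix id (Fin.castLE hrn)).transpose := by
  obtain ⟨s, rfl⟩ := Nat.exists_eq_add_of_le hrn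
  ext i j
  rw [Matrix.mul_apply, Matrix.mul_apply]
  simp [Matrix.mul_diagonal, Fin.sum_univ_add]
  rfl

/-- With `A = U (I_r ⊕ 0) Uᵀ`, a polynomial `P` is `Δ_A`-nilpotent iff the upper-left
`r × r` submatrix of `Uᵀ (Hes P) U` is nilpotent over `ℂ[z]`. -/
theorem stmt9 {n r : ℕ} (hr : 1 ≤ r) (hrn : r ≤ n)
    (A U : Matrix (Fin n) (Fin n) ℂ) (hA : A.IsSymm) (hArank : A.rank = r)
    (hU : IsUnit U)
    (hAU : A = U * Matrix.diagonal (fun i : Fin n => if (i : ℕ) < r then (1 : ℂ) else 0)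
        * U.transpose)
    (P : MvPolynomial (Fin n) ℂ) :
    LNil (Delta A) P ↔
      IsNilpotent
        ((((U.transpose.map fun a => (C a : MvPolynomial (Fin n) ℂ)) * Hes P *
            (U.map fun a => (C a : MvPolynomial (Fin n) ℂ))).submatrix
          (Fin.castLE hrn) (Fin.castLE hrn))) := by
  have h := forall_laplacian_pow_eq_zero_iff_isNilpotent_hessian
    (columnDeriv_comm (U.submatrix id (Fin.castLE hrn))) P
  rw [laplacian_columnDeriv, ← mul_diagonal_mul_transpose_eq_submatrix, ← hAU,
    hessian_columnDeriv] at h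
  exact h
end

section
/- Let A ∈ SM(n, ℂ) have rank r ≥ 1 and let P ∈ ℂ[z_1, …, z_n] have zero constant and linear terms (o(P) ≥ 2). Then P is Δ_A-nilpotent if and only if Δ_A^m(P^m) = 0 for all 1 ≤ m ≤ r. -/
open MvPolynomial

/-- `o(P) ≥ 2`: `P` has no constant term and no linear term. -/
def OrdGe2 {n : ℕ} (P : MvPolynomial (Fin n) ℂ) : Prop :=
  ∀ d : Fin n →₀ ℕ, (d.sum fun _ k => k) < 2 → MvPolynomial.coeff d P = 0

section TraceRecurrence

/-- Cayley–Hamilton: if the first `r` power traces of an `r × r` matrix vanish, all of them do. -/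
lemma Matrix.trace_pow_eq_zero_of_le_card {R ι : Type*} [CommRing R] [Fintype ι] [DecidableEq ι]
    (M : Matrix ι ι R)
    (h : ∀ k, 1 ≤ k → k ≤ Fintype.card ι → (M ^ k).trace = 0) :
    ∀ k, 1 ≤ k → (M ^ k).trace = 0 := by
  intro k
  induction k using Nat.strong_induction_on with
  | _ k ih =>
    intro hk
    rcases le_or_gt k (Fintype.card ι) with hle | hlt
    · exact h k hk hle
    nontriviality R
    have hdeg := M.charpoly_natDegree_eq_dim
    have hCH := M.aeval_self_charpoly
    rw [Polynomial.aeval_eq_sum_range, hdeg, Finset.sum_range_succ] at hCH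
    have hlead : M.charpoly.coeff (Fintype.card ι) = 1 := by
      rw [← hdeg]; exact M.charpoly_monic.coeff_natDegree
    rw [hlead, one_smul] at hCH
    have hmul := congrArg (fun N => (N * M ^ (k - Fintype.card ι)).trace) hCH
    simp only [add_mul, Finset.sum_mul, smul_mul_assoc, ← pow_add, Matrix.trace_add,
      Matrix.trace_sum, Matrix.trace_smul, zero_mul, Matrix.trace_zero] at hmul
    rw [Finset.sum_eq_zero, zero_add, Nat.add_sub_cancel' hlt.le] at hmul
    · exact hmul
    · intro i hi
      rw [Finset.mem_range] at hi
      rw [ih _ (by omega) (by omega), smul_zero]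

/-- Rank factorization. -/
lemma Matrix.exists_eq_mul_of_rank_eq {K m n : Type*} [Field K] [Fintype m] [Fintype n]
    [DecidableEq n] {r : ℕ} (A : Matrix m n K) (hr : A.rank = r) :
    ∃ (B : Matrix m (Fin r) K) (C : Matrix (Fin r) n K), A = B * C := by
  let b := Module.finBasisOfFinrankEq K (LinearMap.range A.mulVecLin) hr
  refine ⟨.of fun i k => (b k : m → K) i,
    .of fun k j => b.repr ⟨A.mulVec (Pi.single j 1), ⟨Pi.single j 1, rfl⟩⟩ k, ?_⟩
  ext i j
  have h := congrArg (fun v : LinearMap.range A.mulVecLin => (v : m → K) i)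
    (b.sum_repr ⟨A.mulVec (Pi.single j 1), ⟨Pi.single j 1, rfl⟩⟩)
  simp only [Submodule.coe_sum, Submodule.coe_smul, Finset.sum_apply, Pi.smul_apply,
    smul_eq_mul] at h
  have hAij : A.mulVec (Pi.single j 1) i = A i j := by simp
  rw [hAij] at h
  rw [Matrix.mul_apply, ← h]
  exact Finset.sum_congr rfl fun k _ => mul_comm _ _

lemma Matrix.trace_mul_pow_comm {R m n : Type*} [CommRing R] [Fintype m] [Fintype n]
    [DecidableEq m] [DecidableEq n] (B : Matrix m n R) (C : Matrix n m R) (k : ℕ) :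
    ((B * C) ^ (k + 1)).trace = ((C * B) ^ (k + 1)).trace := by
  have h : ∀ k : ℕ, (B * C) ^ (k + 1) = B * (C * B) ^ k * C := by
    intro k
    induction k with
    | zero => simp
    | succ k ih => rw [pow_succ, ih, pow_succ (C * B)]; simp only [Matrix.mul_assoc]
  rw [h, Matrix.mul_assoc, Matrix.trace_mul_comm, Matrix.mul_assoc, ← pow_succ]

/-- If `A` has rank `r` and the first `r` power traces of `A * H` vanish, all of them do. -/
lemma Matrix.trace_map_mul_pow_eq_zero {K R ι : Type*} [Field K] [CommRing R] [Algebra K R]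
    [Fintype ι] [DecidableEq ι] {r : ℕ} (A : Matrix ι ι K) (hr : A.rank = r) (H : Matrix ι ι R)
    (h : ∀ k, 1 ≤ k → k ≤ r → ((A.map (algebraMap K R) * H) ^ k).trace = 0) :
    ∀ k, 1 ≤ k → ((A.map (algebraMap K R) * H) ^ k).trace = 0 := by
  obtain ⟨B, C, rfl⟩ := A.exists_eq_mul_of_rank_eq hr
  have key : ∀ k, 1 ≤ k → (((B * C).map (algebraMap K R) * H) ^ k).trace =
      ((C.map (algebraMap K R) * H * B.map (algebraMap K R)) ^ k).trace := by
    intro k hk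
    obtain ⟨k, rfl⟩ := Nat.exists_eq_add_of_le' hk
    rw [Matrix.map_mul, Matrix.mul_assoc, Matrix.trace_mul_pow_comm]
  intro k hk
  rw [key k hk]
  refine Matrix.trace_pow_eq_zero_of_le_card _ (fun k hk hkr => ?_) k hk
  rw [← key k hk]
  exact h k hk (by simpa using hkr)

end TraceRecurrence

section Derivations

variable {K S ι : Type*} [Field K] [CommRing S] [Algebra K S] [Fintype ι]

/-- The second-order operator `∑ a_{ij} D_i D_j`. -/
noncomputable def laplace (A : Matrix ι ι K) (D : ι → Derivation K S S) : Module.End K S :=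
  ∑ i, ∑ j, A i j • ((D i).toLinearMap ∘ₗ (D j).toLinearMap)

/-- The derivation `g ↦ ∑ a_{ij} (D_i f) (D_j g)`. -/
noncomputable def gradDeriv (A : Matrix ι ι K) (D : ι → Derivation K S S) (f : S) :
    Derivation K S S :=
  ∑ i, ∑ j, A i j • D i f • D j

lemma laplace_apply (A : Matrix ι ι K) (D : ι → Derivation K S S) (f : S) :
    laplace A D f = ∑ i, ∑ j, A i j • D i (D j f) := by
  simp [laplace]

lemma gradDeriv_apply (A : Matrix ι ι K) (D : ι → Derivation K S S) (f g : S) :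
    gradDeriv A D f g = ∑ i, ∑ j, A i j • (D i f * D j g) := by
  have h : ∀ (s : Finset ι) (d : ι → Derivation K S S), (∑ i ∈ s, d i) g = ∑ i ∈ s, d i g :=
    fun s d => map_sum
      ((Pi.evalAddMonoidHom (fun _ : S => S) g).comp (Derivation.coeFnAddMonoidHom (R := K))) d s
  simp [gradDeriv, h]

lemma gradDeriv_comm {A : Matrix ι ι K} (hA : A.IsSymm) (D : ι → Derivation K S S) (f g : S) :
    gradDeriv A D f g = gradDeriv A D g f := by
  rw [gradDeriv_apply, gradDeriv_apply, Finset.sum_comm]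
  simp only [mul_comm (D _ g), hA.apply]

lemma laplace_mul {A : Matrix ι ι K} (hA : A.IsSymm) (D : ι → Derivation K S S) (f g : S) :
    laplace A D (f * g) = f * laplace A D g + g * laplace A D f + 2 * gradDeriv A D f g := by
  have h : laplace A D (f * g) = f * laplace A D g + g * laplace A D f +
      gradDeriv A D f g + gradDeriv A D g f := by
    simp only [laplace_apply, gradDeriv_apply, Finset.mul_sum, ← Finset.sum_add_distrib,
      Derivation.leibniz, smul_eq_mul, map_add, mul_smul_comm, ← smul_add]
    refine Finset.sum_congr rfl fun i _ => Finset.sum_congr rfl fun j _ => ?_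
    congr 1
    ring
  rw [h, gradDeriv_comm hA D g f]
  ring

lemma Derivation.apply_pow_eq_of_apply_eq (d e : Derivation K S S) {f : S} (h : d f = e f)
    (m : ℕ) : d (f ^ m) = e (f ^ m) := by
  rw [Derivation.leibniz_pow, Derivation.leibniz_pow, h]

/-- Along `T Q = ½ ⟨∇Q, ∇Q⟩` the Laplacian of a power of `Q` is governed by `T`. -/
lemma laplace_pow_succ {A : Matrix ι ι K} (hA : A.IsSymm) (D : ι → Derivation K S S)
    (T : Derivation K S S) {Q : S} (hQ : 2 * T Q = gradDeriv A D Q Q) (m : ℕ) :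
    laplace A D (Q ^ (m + 1)) =
      (m + 1) * Q ^ m * laplace A D Q + 2 * (m + 1) * T (Q ^ m) := by
  have hgrad : ∀ m : ℕ, gradDeriv A D (Q ^ m) Q = 2 * T (Q ^ m) := by
    intro m
    rw [gradDeriv_comm hA, Derivation.apply_pow_eq_of_apply_eq (gradDeriv A D Q) ((2 : S) • T)
      (by simp [← hQ])]
    rfl
  induction m with
  | zero => simp
  | succ m ih =>
    have hT : (m + 1) * (Q * T (Q ^ m)) = m * T (Q ^ (m + 1)) := by
      rcases m with _ | m
      · simp
      · simp only [Derivation.leibniz_pow, smul_eq_mul, nsmul_eq_mul, Nat.add_sub_cancel]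
        push_cast
        ring
    rw [pow_succ, laplace_mul hA, ih, hgrad]
    push_cast
    linear_combination 2 * hT

/-- The Hessian matrix multiplied by the coefficient matrix. -/
noncomputable def hessMul (A : Matrix ι ι K) (D : ι → Derivation K S S) (f : S) : Matrix ι ι S :=
  A.map (algebraMap K S) * .of fun i j => D i (D j f)

lemma trace_hessMul {A : Matrix ι ι K} (D : ι → Derivation K S S)
    (hD : ∀ i j f, D i (D j f) = D j (D i f)) (f : S) :
    (hessMul A D f).trace = laplace A D f := by
  simp only [Matrix.trace, hessMul, Matrix.diag_apply, Matrix.mul_apply, Matrix.map_apply,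
    Matrix.of_apply, laplace_apply, ← Algebra.smul_def]
  exact Finset.sum_congr rfl fun i _ => Finset.sum_congr rfl fun j _ => by rw [hD]

lemma Derivation.map_matrix_mul (d : Derivation K S S) (M N : Matrix ι ι S) :
    (M * N).map d = M.map d * N + M * N.map d := by
  ext i j
  simp only [Matrix.map_apply, Matrix.mul_apply, map_sum, Matrix.add_apply,
    ← Finset.sum_add_distrib, Derivation.leibniz, smul_eq_mul]
  exact Finset.sum_congr rfl fun k _ => by ring

lemma Derivation.apply_trace (d : Derivation K S S) (M : Matrix ι ι S) :
    d M.trace = (M.map d).trace := by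
  simp [Matrix.trace]

lemma Derivation.map_matrix_pow [DecidableEq ι] (d : Derivation K S S) {M : Matrix ι ι S}
    (h : M.map d = M * M) (k : ℕ) : (M ^ k).map d = (k : S) • M ^ (k + 1) := by
  induction k with
  | zero => ext i j; simp [Matrix.one_apply, apply_ite d]
  | succ k ih =>
    rw [pow_succ M k, d.map_matrix_mul, ih, h, Matrix.smul_mul, ← pow_succ, ← Matrix.mul_assoc,
      ← pow_succ, ← pow_succ]
    push_cast
    rw [add_smul, one_smul]

/-- Repeatedly differentiating the trace of a solution of the Riccati equation `d M = M ^ 2`. -/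
lemma Derivation.iterate_trace [DecidableEq ι] (d : Derivation K S S) {M : Matrix ι ι S}
    (h : M.map d = M * M) (k : ℕ) : d^[k] M.trace = (k.factorial : S) * (M ^ (k + 1)).trace := by
  induction k with
  | zero => simp
  | succ k ih =>
    rw [Function.iterate_succ_apply', ih, Derivation.leibniz, d.apply_trace, d.map_matrix_pow h,
      Derivation.map_natCast, Matrix.trace_smul, Nat.factorial_succ]
    push_cast
    simp only [smul_eq_mul]
    ring

/-- The Hessian of a solution of `T Q = ½ ⟨∇Q, ∇Q⟩` satisfies a Riccati equation. -/
lemma hessMul_map [CharZero K] {A : Matrix ι ι K} (hA : A.IsSymm) (D : ι → Derivation K S S)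
    (hD : ∀ i j f, D i (D j f) = D j (D i f)) (T : Derivation K S S)
    (hT : ∀ i f, T (D i f) = D i (T f)) {Q : S} (hQ : 2 * T Q = gradDeriv A D Q Q) :
    (hessMul A D Q).map (T - gradDeriv A D Q) = hessMul A D Q * hessMul A D Q := by
  have hentry : ∀ l k, (T - gradDeriv A D Q) (D l (D k Q)) =
      ∑ p, ∑ q, A p q • (D l (D p Q) * D q (D k Q)) := by
    intro l k
    have h2 : (2 : S) * T (D l (D k Q)) = D l (D k (gradDeriv A D Q Q)) := by
      rw [← hQ, hT, hT]
      simp [two_mul]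
    have hsym : ∑ p, ∑ q, A p q • (D k (D p Q) * D l (D q Q)) =
        ∑ p, ∑ q, A p q • (D l (D p Q) * D q (D k Q)) := by
      rw [Finset.sum_comm]
      refine Finset.sum_congr rfl fun p _ => Finset.sum_congr rfl fun q _ => ?_
      rw [hA.apply, hD k q, mul_comm]
    have hsym' : gradDeriv A D (D l (D k Q)) Q = gradDeriv A D Q (D l (D k Q)) :=
      gradDeriv_comm hA D _ _
    have hexp : D l (D k (gradDeriv A D Q Q)) =
        gradDeriv A D (D l (D k Q)) Q + gradDeriv A D Q (D l (D k Q)) +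
        ∑ p, ∑ q, A p q • (D k (D p Q) * D l (D q Q)) +
        ∑ p, ∑ q, A p q • (D l (D p Q) * D q (D k Q)) := by
      simp only [gradDeriv_apply, map_sum, Derivation.map_smul, Derivation.leibniz, smul_eq_mul,
        map_add, ← Finset.sum_add_distrib, ← smul_add]
      refine Finset.sum_congr rfl fun p _ => Finset.sum_congr rfl fun q _ => ?_
      congr 1
      rw [hD p l (D k Q), hD p k, hD q l (D k Q), hD q k]
      ring
    rw [hexp, hsym, hsym'] at h2
    have two_ne : (2 : K) ≠ 0 := two_ne_zero
    have h3 : (2 : K) • (T (D l (D k Q)) - gradDeriv A D Q (D l (D k Q)) -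
        ∑ p, ∑ q, A p q • (D l (D p Q) * D q (D k Q))) = 0 := by
      rw [Algebra.smul_def, map_ofNat]
      linear_combination h2
    have h4 := (smul_eq_zero_iff_right two_ne).mp h3
    rw [Derivation.sub_apply]
    exact sub_eq_zero.mp h4
  ext i j
  simp only [Matrix.map_apply, hessMul, Matrix.mul_apply, Matrix.of_apply, map_sum,
    ← Algebra.smul_def, Derivation.map_smul, hentry, Finset.smul_sum, Finset.sum_mul,
    Finset.mul_sum, smul_mul_assoc, mul_smul_comm]
  rw [Finset.sum_comm]
  refine Finset.sum_congr rfl fun p _ => ?_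
  rw [Finset.sum_comm]
  exact Finset.sum_congr rfl fun x _ => Finset.sum_congr rfl fun y _ => smul_comm _ _ _

end Derivations

section HamiltonJacobi

variable {K R ι : Type*} [Field K] [CommRing R] [Algebra K R] [Fintype ι]

/-- The coefficientwise extension of a derivation to power series. -/
noncomputable def Derivation.mapPowerSeries (d : Derivation K R R) :
    Derivation K (PowerSeries R) (PowerSeries R) :=
  Derivation.mk'
    { toFun := fun f => PowerSeries.mk fun n => d (PowerSeries.coeff n f)
      map_add' := fun f g => by ext; simp
      map_smul' := fun c f => by ext; simp }
    fun f g => by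
      ext n
      simp only [LinearMap.coe_mk, AddHom.coe_mk, PowerSeries.coeff_mk, PowerSeries.coeff_mul,
        map_sum, Derivation.leibniz, smul_eq_mul, map_add, Finset.sum_add_distrib]
      congr 1
      rw [← Finset.Nat.sum_antidiagonal_swap]
      rfl

@[simp]
lemma Derivation.coeff_mapPowerSeries (d : Derivation K R R) (f : PowerSeries R) (n : ℕ) :
    PowerSeries.coeff n (d.mapPowerSeries f) = d (PowerSeries.coeff n f) := by
  simp [Derivation.mapPowerSeries]

variable (K R) in
/-- The formal derivative of power series as a `K`-linear derivation. -/
noncomputable def seriesDeriv : Derivation K (PowerSeries R) (PowerSeries R) :=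
  (PowerSeries.derivative R).restrictScalars K

@[simp]
lemma coeff_seriesDeriv (f : PowerSeries R) (n : ℕ) :
    PowerSeries.coeff n (seriesDeriv K R f) = PowerSeries.coeff (n + 1) f * (n + 1) :=
  PowerSeries.coeff_derivative f n

lemma seriesDeriv_mapPowerSeries (d : Derivation K R R) (f : PowerSeries R) :
    seriesDeriv K R (d.mapPowerSeries f) = d.mapPowerSeries (seriesDeriv K R f) := by
  ext n
  have h : d ((n : R) + 1) = 0 := by simp
  simp [h, mul_comm]

/-- The coefficientwise extension of a family of derivations. -/
noncomputable abbrev seriesFamily (D : ι → Derivation K R R) :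
    ι → Derivation K (PowerSeries R) (PowerSeries R) := fun i => (D i).mapPowerSeries

lemma coeff_laplace (A : Matrix ι ι K) (D : ι → Derivation K R R) (f : PowerSeries R) (n : ℕ) :
    PowerSeries.coeff n (laplace A (seriesFamily D) f) = laplace A D (PowerSeries.coeff n f) := by
  simp [laplace_apply]

lemma coeff_laplace_pow (A : Matrix ι ι K) (D : ι → Derivation K R R) (f : PowerSeries R)
    (n k : ℕ) : PowerSeries.coeff n ((laplace A (seriesFamily D) ^ k) f) =
      (laplace A D ^ k) (PowerSeries.coeff n f) := by
  induction k with
  | zero => simp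
  | succ k ih => rw [pow_succ', pow_succ', Module.End.mul_apply, Module.End.mul_apply,
      coeff_laplace, ih]

lemma coeff_eq_zero_of_X_pow_dvd {f : PowerSeries R} {n k : ℕ}
    (h : PowerSeries.X ^ k ∣ f) (hn : n < k) : PowerSeries.coeff n f = 0 :=
  PowerSeries.X_pow_dvd_iff.mp h n hn

lemma X_pow_dvd_gradDeriv (A : Matrix ι ι K) (D : ι → Derivation K R R) (Q : PowerSeries R)
    {f : PowerSeries R} {k : ℕ} (h : PowerSeries.X ^ k ∣ f) :
    PowerSeries.X ^ k ∣ gradDeriv A (seriesFamily D) Q f := by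
  rw [gradDeriv_apply]
  refine Finset.dvd_sum fun i _ => Finset.dvd_sum fun j _ => ?_
  rw [Algebra.smul_def]
  refine Dvd.dvd.mul_left (Dvd.dvd.mul_left ?_ _) _
  rw [PowerSeries.X_pow_dvd_iff] at h ⊢
  intro m hm
  rw [Derivation.coeff_mapPowerSeries, h m hm, map_zero]

/-- Modifying the formal derivative by a gradient derivation does not change leading terms. -/
lemma coeff_zero_iterate (A : Matrix ι ι K) (D : ι → Derivation K R R) (Q : PowerSeries R)
    (k : ℕ) : ∀ f : PowerSeries R, PowerSeries.X ^ k ∣ f →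
      PowerSeries.coeff 0 ((seriesDeriv K R - gradDeriv A (seriesFamily D) Q)^[k] f) =
        (k.factorial : R) * PowerSeries.coeff k f := by
  induction k with
  | zero => simp
  | succ k ih =>
    intro f hf
    have hg := X_pow_dvd_gradDeriv A D Q hf
    rw [Function.iterate_succ_apply, ih, Derivation.sub_apply, map_sub,
      coeff_eq_zero_of_X_pow_dvd hg k.lt_succ_self, coeff_seriesDeriv, Nat.factorial_succ]
    · push_cast
      ring
    · rw [Derivation.sub_apply]
      refine dvd_sub ?_ ((pow_dvd_pow _ k.le_succ).trans hg)
      rw [PowerSeries.X_pow_dvd_iff] at hf ⊢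
      intro m hm
      rw [coeff_seriesDeriv, hf _ (by omega), zero_mul]

/-- Coefficients of the solution of `∂ₜ Q = ½ ⟨∇Q, ∇Q⟩` with initial value `P`. -/
noncomputable def hjCoeff (A : Matrix ι ι K) (D : ι → Derivation K R R) (P : R) : ℕ → R
  | 0 => P
  | k + 1 => (2 * (k + 1) : K)⁻¹ •
      ∑ p : Fin (k + 1), gradDeriv A D (hjCoeff A D P p) (hjCoeff A D P (k - p))

lemma coeff_gradDeriv (A : Matrix ι ι K) (D : ι → Derivation K R R) (f g : PowerSeries R) (n : ℕ) :
    PowerSeries.coeff n (gradDeriv A (seriesFamily D) f g) =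
      ∑ p ∈ Finset.HasAntidiagonal.antidiagonal n,
        gradDeriv A D (PowerSeries.coeff p.1 f) (PowerSeries.coeff p.2 g) := by
  simp only [gradDeriv_apply, map_sum, PowerSeries.coeff_smul, PowerSeries.coeff_mul,
    Derivation.coeff_mapPowerSeries, Finset.smul_sum]
  rw [Finset.sum_comm]
  simp only [Finset.sum_comm (s := Finset.HasAntidiagonal.antidiagonal n)]
  rw [Finset.sum_comm]

lemma exists_hamiltonJacobi [CharZero K] (A : Matrix ι ι K) (D : ι → Derivation K R R) (P : R) :
    ∃ Q : PowerSeries R, PowerSeries.coeff 0 Q = P ∧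
      2 * seriesDeriv K R Q = gradDeriv A (seriesFamily D) Q Q := by
  refine ⟨PowerSeries.mk (hjCoeff A D P), by simp [hjCoeff], ?_⟩
  ext n
  rw [coeff_gradDeriv, two_mul, map_add, ← two_mul,
    coeff_seriesDeriv, Finset.Nat.sum_antidiagonal_eq_sum_range_succ_mk, ← Fin.sum_univ_eq_sum_range
      (fun p => gradDeriv A D (PowerSeries.coeff p (PowerSeries.mk (hjCoeff A D P)))
        (PowerSeries.coeff (n - p) (PowerSeries.mk (hjCoeff A D P))))]
  simp only [PowerSeries.coeff_mk]
  rw [hjCoeff]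
  have hn : (2 * (n + 1) : K) ≠ 0 := mul_ne_zero two_ne_zero (by exact_mod_cast n.succ_ne_zero)
  have hcast : algebraMap K R (2 * (n + 1)) = 2 * (n + 1) := by
    rw [map_mul, map_add, map_ofNat, map_natCast, map_one]
  rw [mul_comm _ ((n : R) + 1), ← mul_assoc, ← hcast, ← Algebra.smul_def, smul_inv_smul₀ hn]

lemma X_pow_dvd_laplace_pow (A : Matrix ι ι K) (D : ι → Derivation K R R)
    {f : PowerSeries R} {k : ℕ} (h : PowerSeries.X ^ k ∣ f) (j : ℕ) :
    PowerSeries.X ^ k ∣ (laplace A (seriesFamily D) ^ j) f := by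
  rw [PowerSeries.X_pow_dvd_iff] at h ⊢
  intro m hm
  rw [coeff_laplace_pow, h m hm, map_zero]

lemma seriesDeriv_laplace_pow (A : Matrix ι ι K) (D : ι → Derivation K R R)
    (f : PowerSeries R) (j : ℕ) :
    seriesDeriv K R ((laplace A (seriesFamily D) ^ j) f) =
      (laplace A (seriesFamily D) ^ j) (seriesDeriv K R f) := by
  induction j with
  | zero => simp
  | succ j ih =>
    rw [pow_succ', Module.End.mul_apply, Module.End.mul_apply, ← ih]
    simp [laplace_apply, seriesDeriv_mapPowerSeries]

lemma coeff_succ_laplace_pow {A : Matrix ι ι K} (hA : A.IsSymm) {D : ι → Derivation K R R}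
    {Q : PowerSeries R}
    (hQ : 2 * seriesDeriv K R Q = gradDeriv A (seriesFamily D) Q Q) {k : ℕ}
    (hk : PowerSeries.X ^ k ∣ laplace A (seriesFamily D) Q) {i : ℕ} (hi : i < k) (j : ℕ) :
    (2 * (j + 2) * (i + 1) : K) •
      PowerSeries.coeff (i + 1) ((laplace A (seriesFamily D) ^ (j + 1)) (Q ^ (j + 1))) =
    PowerSeries.coeff i ((laplace A (seriesFamily D) ^ (j + 2)) (Q ^ (j + 2))) := by
  have h := congrArg (fun f => PowerSeries.coeff i ((laplace A (seriesFamily D) ^ (j + 1)) f))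
    (laplace_pow_succ hA (seriesFamily D) (seriesDeriv K R) hQ (j + 1))
  have hz := coeff_eq_zero_of_X_pow_dvd (X_pow_dvd_laplace_pow A D
    (Dvd.dvd.mul_left hk (((j + 1 : ℕ) + 1) * Q ^ (j + 1))) (j + 1)) hi
  have hs : (2 * ((j + 1 : ℕ) + 1) : PowerSeries R) * seriesDeriv K R (Q ^ (j + 1)) =
      (2 * (j + 2) : K) • seriesDeriv K R (Q ^ (j + 1)) := by
    rw [Algebra.smul_def]
    congr 1
    push_cast [map_mul, map_add, map_ofNat, map_natCast]
    ring
  simp only [map_add, hs, map_smul, ← seriesDeriv_laplace_pow] at h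
  rw [hz, zero_add, PowerSeries.coeff_smul, coeff_seriesDeriv, ← Module.End.mul_apply,
    ← pow_succ] at h
  rw [h, mul_smul]
  congr 1
  rw [Algebra.smul_def, mul_comm]
  simp

/-- The first possibly nonzero coefficient of the Laplacian of the solution is a multiple of
`Λ ^ (k + 1) (P ^ (k + 1))`. -/
lemma exists_smul_coeff_laplace [CharZero K] {A : Matrix ι ι K} (hA : A.IsSymm)
    {D : ι → Derivation K R R} {Q : PowerSeries R}
    (hQ : 2 * seriesDeriv K R Q = gradDeriv A (seriesFamily D) Q Q) {k : ℕ}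
    (hk : PowerSeries.X ^ k ∣ laplace A (seriesFamily D) Q) :
    ∃ c : K, c ≠ 0 ∧ c • PowerSeries.coeff k (laplace A (seriesFamily D) Q) =
      (laplace A D ^ (k + 1)) (PowerSeries.coeff 0 Q ^ (k + 1)) := by
  have key : ∀ j i, i + j = k → ∃ c : K, c ≠ 0 ∧
      c • PowerSeries.coeff k (laplace A (seriesFamily D) Q) =
        PowerSeries.coeff i ((laplace A (seriesFamily D) ^ (j + 1)) (Q ^ (j + 1))) := by
    intro j
    induction j with
    | zero =>
      rintro i rfl
      exact ⟨1, one_ne_zero, by simp⟩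
    | succ j ih =>
      intro i hij
      obtain ⟨c, hc, h⟩ := ih (i + 1) (by omega)
      refine ⟨2 * (j + 2) * (i + 1) * c, mul_ne_zero (mul_ne_zero (mul_ne_zero two_ne_zero ?_) ?_)
        hc, ?_⟩
      · exact_mod_cast (j + 1).succ_ne_zero
      · exact_mod_cast i.succ_ne_zero
      · rw [mul_smul, h, coeff_succ_laplace_pow hA hQ hk (by omega)]
  obtain ⟨c, hc, h⟩ := key k 0 (by simp)
  refine ⟨c, hc, ?_⟩
  rw [h, coeff_laplace_pow]
  simp

/-- The first possibly nonzero coefficient of the Laplacian of the solution is a power trace. -/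
lemma coeff_laplace_eq_trace [CharZero K] [DecidableEq ι] {A : Matrix ι ι K} (hA : A.IsSymm)
    {D : ι → Derivation K R R} (hD : ∀ i j f, D i (D j f) = D j (D i f)) {Q : PowerSeries R}
    (hQ : 2 * seriesDeriv K R Q = gradDeriv A (seriesFamily D) Q Q) {k : ℕ}
    (hk : PowerSeries.X ^ k ∣ laplace A (seriesFamily D) Q) :
    PowerSeries.coeff k (laplace A (seriesFamily D) Q) =
      (hessMul A D (PowerSeries.coeff 0 Q) ^ (k + 1)).trace := by
  have hD' : ∀ i j f, seriesFamily D i (seriesFamily D j f) =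
      seriesFamily D j (seriesFamily D i f) := by
    intro i j f
    ext n
    simp [hD i j]
  have h1 := coeff_zero_iterate A D Q k _ hk
  rw [← trace_hessMul (seriesFamily D) hD', Derivation.iterate_trace _
    (hessMul_map hA (seriesFamily D) hD' (seriesDeriv K R)
      (fun i f => seriesDeriv_mapPowerSeries (D i) f) hQ)] at h1
  have hmap : (PowerSeries.constantCoeff (R := R)).mapMatrix (hessMul A (seriesFamily D) Q) =
      hessMul A D (PowerSeries.coeff 0 Q) := by
    ext i j
    rw [RingHom.mapMatrix_apply, Matrix.map_apply, ← PowerSeries.coeff_zero_eq_constantCoeff_apply]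
    simp [hessMul, Matrix.mul_apply, ← Algebra.smul_def, -PowerSeries.coeff_zero_eq_constantCoeff]
  have htr : PowerSeries.constantCoeff ((hessMul A (seriesFamily D) Q ^ (k + 1)).trace) =
      (hessMul A D (PowerSeries.coeff 0 Q) ^ (k + 1)).trace := by
    rw [← hmap, ← map_pow, AddMonoidHom.map_trace]
    rfl
  have hfac : ((k.factorial : K)) ≠ 0 := by exact_mod_cast k.factorial_ne_zero
  have h2 : (k.factorial : K) • (hessMul A D (PowerSeries.coeff 0 Q) ^ (k + 1)).trace =
      (k.factorial : K) • PowerSeries.coeff k (hessMul A (seriesFamily D) Q).trace := by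
    simpa [Algebra.smul_def, htr] using h1
  rw [← trace_hessMul (seriesFamily D) hD']
  exact (smul_right_injective R hfac h2).symm

/-- For `A` symmetric of rank `r`, the vanishing of `Λ ^ m (P ^ m)` for `1 ≤ m ≤ r`
implies it for all `m ≥ 1`. -/
theorem laplace_pow_eq_zero [CharZero K] [DecidableEq ι] {A : Matrix ι ι K} (hA : A.IsSymm)
    {r : ℕ} (hr : A.rank = r) {D : ι → Derivation K R R}
    (hD : ∀ i j f, D i (D j f) = D j (D i f)) (P : R)
    (h : ∀ m, 1 ≤ m → m ≤ r → (laplace A D ^ m) (P ^ m) = 0) :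
    ∀ m, 1 ≤ m → (laplace A D ^ m) (P ^ m) = 0 := by
  obtain ⟨Q, rfl, hQ⟩ := exists_hamiltonJacobi A D P
  have step : ∀ k, PowerSeries.X ^ k ∣ laplace A (seriesFamily D) Q →
      PowerSeries.coeff k (laplace A (seriesFamily D) Q) = 0 →
      PowerSeries.X ^ (k + 1) ∣ laplace A (seriesFamily D) Q := by
    intro k hk h0
    rw [PowerSeries.X_pow_dvd_iff] at hk ⊢
    intro m hm
    rcases Nat.lt_succ_iff_lt_or_eq.mp hm with hm | rfl
    exacts [hk m hm, h0]
  have hdvd : ∀ k, k ≤ r → PowerSeries.X ^ k ∣ laplace A (seriesFamily D) Q := by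
    intro k
    induction k with
    | zero => simp
    | succ k ih =>
      intro hkr
      have hk := ih (by omega)
      obtain ⟨c, hc, hck⟩ := exists_smul_coeff_laplace hA hQ hk
      rw [h _ (by omega) hkr] at hck
      exact step k hk ((smul_eq_zero_iff_right hc).mp hck)
  have htrace : ∀ m, 1 ≤ m → (hessMul A D (PowerSeries.coeff 0 Q) ^ m).trace = 0 := by
    refine Matrix.trace_map_mul_pow_eq_zero A hr _ fun m hm hmr => ?_
    obtain ⟨k, rfl⟩ := Nat.exists_eq_add_of_le' hm
    refine (coeff_laplace_eq_trace hA hD hQ (hdvd k (by omega))).symm.trans ?_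
    exact coeff_eq_zero_of_X_pow_dvd (hdvd _ hmr) k.lt_succ_self
  have hall : ∀ k, PowerSeries.X ^ k ∣ laplace A (seriesFamily D) Q := by
    intro k
    induction k with
    | zero => simp
    | succ k ih =>
      exact step k ih ((coeff_laplace_eq_trace hA hD hQ ih).trans (htrace _ (by omega)))
  intro m hm
  obtain ⟨k, rfl⟩ := Nat.exists_eq_add_of_le' hm
  obtain ⟨c, -, hck⟩ := exists_smul_coeff_laplace hA hQ (hall k)
  rw [← hck, coeff_eq_zero_of_X_pow_dvd (hall (k + 1)) k.lt_succ_self, smul_zero]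

end HamiltonJacobi

lemma MvPolynomial.pderiv_pderiv_comm {σ R : Type*} [CommRing R] (i j : σ)
    (f : MvPolynomial σ R) : pderiv i (pderiv j f) = pderiv j (pderiv i f) := by
  classical
  have h : ⁅(pderiv i : Derivation R (MvPolynomial σ R) (MvPolynomial σ R)),
      (pderiv j : Derivation R (MvPolynomial σ R) (MvPolynomial σ R))⁆ = 0 := by
    refine MvPolynomial.derivation_ext fun k => ?_
    simp only [Derivation.commutator_apply, pderiv_X, Pi.single_apply]
    split_ifs <;> simp
  have h' := congrArg (fun d : Derivation R (MvPolynomial σ R) (MvPolynomial σ R) => d f) h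
  simpa [Derivation.commutator_apply, sub_eq_zero] using h'

/-- For `A` symmetric of rank `r ≥ 1` and `P` with `o(P) ≥ 2`, `P` is `Δ_A`-nilpotent
iff `Δ_A^m(P^m) = 0` for all `1 ≤ m ≤ r`. -/
theorem stmt10 {n r : ℕ} (A : Matrix (Fin n) (Fin n) ℂ) (hA : A.IsSymm)
    (hr : 1 ≤ r) (hArank : A.rank = r) (P : MvPolynomial (Fin n) ℂ) (hP : OrdGe2 P) :
    LNil (Delta A) P ↔ ∀ m : ℕ, 1 ≤ m → m ≤ r → ((Delta A) ^ m) (P ^ m) = 0 := by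
  exact ⟨fun h m hm _ => h m hm,
    fun h => laplace_pow_eq_zero hA hArank MvPolynomial.pderiv_pderiv_comm P h⟩
end
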